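/- Let μ be a C^∞-smooth real-valued function on D̄ with μ(z) ≤ 2/(1−|z|²)² for all z ∈ D (i.e. the 2-form μ dΣ plus half the hyperbolic curvature form is ≤ 0). Define ω₁(z) = exp(−∫_D log|(z−w)/(1−z·conj(w))| μ(w) dΣ(w)) for z ∈ D. Suppose K : D̄ × D → ℂ is such that for every w ∈ D the function K(·,w) is holomorphic on D, C¹ on D̄, belongs to A²(D,ω₁), and reproduces at w for the weight ω₁. Then: (i) K(z,w) ≠ 0 for all z ∈ D̄ and w ∈ D; (ii) the weight ω₀(z) := |K(z,0)|² ω₁(z) / K(0,0) is strictly positive on D̄, satisfies Δ log ω₀(z) = −μ(z)/2 for z ∈ D, ∫_D ω₀ dΣ = 1, and ∫_D h(z) ω₀(z) dΣ(z) = h(0) for every bounded harmonic function h on D; (iii) ω(0) ≤ ω₀(0) for every strictly positive C^∞-smooth weight ω on D̄ with Δ log ω = −μ/2 on D and ∫_D ω dΣ = 1. -/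

import Mathlib

open Complex MeasureTheory Metric Set

noncomputable section

/-- The open unit disk in ℂ. -/
def unitDisk : Set ℂ := Metric.ball 0 1

/-- The closed unit disk in ℂ. -/
def closedDisk : Set ℂ := Metric.closedBall 0 1

/-- The unit circle in ℂ. -/
def unitCircle : Set ℂ := Metric.sphere 0 1

/-- The normalized area measure dΣ = dx dy / π on ℂ. -/
def dSigma : Measure ℂ := (ENNReal.ofReal (1 / Real.pi)) • (volume : Measure ℂ)

/-- The normalized Laplacian Δ = (1/4)(∂²ₓ + ∂²_y) of a real-valued function on ℂ. -/
def lapR (u : ℂ → ℝ) (z : ℂ) : ℝ :=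
  (1/4) * (fderiv ℝ (fun w => fderiv ℝ u w 1) z 1
    + fderiv ℝ (fun w => fderiv ℝ u w Complex.I) z Complex.I)

/-- The normalized Laplacian Δ = (1/4)(∂²ₓ + ∂²_y) of a complex-valued function on ℂ. -/
def lapC (u : ℂ → ℂ) (z : ℂ) : ℂ :=
  (1/4) * (fderiv ℝ (fun w => fderiv ℝ u w 1) z 1
    + fderiv ℝ (fun w => fderiv ℝ u w Complex.I) z Complex.I)

/-- Membership in the weighted Bergman space A²(𝔻, ω): holomorphic on the unit disk
and square integrable against the weight ω with respect to dΣ. -/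
def MemA2 (ω : ℂ → ℝ) (f : ℂ → ℂ) : Prop :=
  DifferentiableOn ℂ f unitDisk ∧
    IntegrableOn (fun z => ‖f z‖ ^ 2 * ω z) unitDisk dSigma

/-- `k` reproduces at `w` for the weight `ω`. -/
def Reproduces (ω : ℂ → ℝ) (k : ℂ → ℂ) (w : ℂ) : Prop :=
  MemA2 ω k ∧ ∀ f : ℂ → ℂ, MemA2 ω f →
    ∫ z in unitDisk, f z * (starRingEnd ℂ) (k z) * (ω z : ℂ) ∂dSigma = f w

/-- A bounded (complex-valued) harmonic function on the unit disk. -/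
def BoundedHarmonicC (h : ℂ → ℂ) : Prop :=
  ContDiffOn ℝ 2 h unitDisk ∧ (∀ z ∈ unitDisk, lapC h z = 0) ∧
    ∃ M : ℝ, ∀ z ∈ unitDisk, ‖h z‖ ≤ M

/-- A bounded real-valued harmonic function on the unit disk. -/
def BoundedHarmonicR (h : ℂ → ℝ) : Prop :=
  ContDiffOn ℝ 2 h unitDisk ∧ (∀ z ∈ unitDisk, lapR h z = 0) ∧
    ∃ M : ℝ, ∀ z ∈ unitDisk, |h z| ≤ M

section

lemma alg_braces (P n d r : ℝ) (hP0 : 0 < P) (hP1 : P ≤ 1) (hr : 0 ≤ r) (hn : n = r ^ 2)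
    (h : 1 + d * n + (1 - d) * (P * n) ≤ 2 * r) :
    0 ≤ n - P * n - 5 / 2 * (P * n) * n + n ^ 2 - d * (P * n) * n ^ 2 + 2 * (P * n) ^ 2
      + 2 * d * (P * n) ^ 2 * n + (1 - d) * (P * n) ^ 3 := by
  have h1 : (1 - P * r) ^ 2 ≤ (1 - P) * (1 - d * (P * n)) := by
    subst hn; nlinarith [mul_le_mul_of_nonneg_left h hP0.le]
  have e : n - P * n - 5 / 2 * (P * n) * n + n ^ 2 - d * (P * n) * n ^ 2 + 2 * (P * n) ^ 2
      + 2 * d * (P * n) ^ 2 * n + (1 - d) * (P * n) ^ 3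
      = n * (1 - P) + P ^ 3 * n ^ 3 + n ^ 2 * (1 - P) * ((1 - P) * (1 - d * (P * n)))
        - 1 / 2 * P * n ^ 2 + P ^ 2 * n ^ 2 := by ring
  rw [e]
  have hn0 : 0 ≤ n := by rw [hn]; positivity
  have h2 : n ^ 2 * (1 - P) * (1 - P * r) ^ 2 ≤ n ^ 2 * (1 - P) * ((1 - P) * (1 - d * (P * n))) :=
    mul_le_mul_of_nonneg_left h1 (mul_nonneg (by positivity) (by linarith))
  have h3 : 0 ≤ n * (1 - P) := mul_nonneg hn0 (by linarith)
  have h4 : P ^ 3 * n ^ 3 + n ^ 2 * (1 - P) * (1 - P * r) ^ 2 - 1 / 2 * P * n ^ 2 + P ^ 2 * n ^ 2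
      = n ^ 2 * ((P * r - (1 - P)) ^ 2 + P / 2) := by rw [hn]; ring
  have h5 : 0 ≤ n ^ 2 * ((P * r - (1 - P)) ^ 2 + P / 2) := by positivity
  linarith

/-- real form of the key inequality -/
lemma alg_real (p n u a2 : ℝ) (hp0 : 0 ≤ p) (hp1 : p < 1) (hn : 0 ≤ n) (ha0 : 0 ≤ a2) (ha1 : a2 ≤ 1)
    (hu : u ^ 2 ≤ n) (h : a2 * p * n = n - 2 * u + 1) :
    (a2 / 4) * ((4 * a2 * n ^ 3 - 4 * n ^ 2 * (4 * n - 4 * u + 1) + 6 * p * n ^ 2 * (4 * n)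
        - 4 * p ^ 2 * n ^ 2 * (4 * n + 4 * u + 1) + p ^ 3 * n ^ 2 * (4 * n + 8 * u + 4))
      + 2 * (a2 * n ^ 2 - 3 * n * n + 3 * p * n * (n + 2 * u + 1) - p ^ 2 * n * (n + 4 * u + 4)))
    ≤ (1 - p) * (2 - 2 * (1 - a2) * u - 2 * (4 * u ^ 3 - 3 * u * n)
        + 2 * (1 - a2) * n * (2 * u ^ 2 - n) - a2) := by
  have hr := Real.sqrt_nonneg n
  have hr2 : n = (Real.sqrt n) ^ 2 := (Real.sq_sqrt hn).symm
  have hur : u ≤ Real.sqrt n := Real.le_sqrt_of_sq_le hu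
  have hb := alg_braces (1 - p) n (1 - a2) (Real.sqrt n) (by linarith) (by linarith) hr hr2 (by
    nlinarith)
  have hu' : u = (1 + n - a2 * p * n) / 2 := by linarith
  have key : 0 ≤ (1 - p) * (a2 * ((1 - a2) * (n - (1 - p) * n - 5 / 2 * ((1 - p) * n) * n + n ^ 2
      - (1 - a2) * ((1 - p) * n) * n ^ 2 + 2 * ((1 - p) * n) ^ 2
      + 2 * (1 - a2) * ((1 - p) * n) ^ 2 * n + (1 - (1 - a2)) * ((1 - p) * n) ^ 3))) :=
    mul_nonneg (by linarith) (mul_nonneg ha0 (mul_nonneg (by linarith) hb))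
  subst hu'
  clear h hu hur hb hr2
  nlinarith [key]
end

section

lemma nsq (z : ℂ) : ‖z‖ ^ 2 = z.re ^ 2 + z.im ^ 2 := by
  rw [← Complex.normSq_eq_norm_sq, Complex.normSq_apply]; ring

lemma alg_cplx (ζ α s : ℂ) (hζ : ‖ζ‖ < 1) (hα : ‖α‖ < 1) (hs : s * (1 - α * ζ) = 1) :
    (‖α‖ ^ 2 / 4) * ((‖2 * α * s ^ 3‖ ^ 2 - 4 * ‖s ^ 2 + 2 * α * ζ * s ^ 3‖ ^ 2
        + 6 * ‖2 * ζ * s ^ 2 + 2 * α * ζ ^ 2 * s ^ 3‖ ^ 2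
        - 4 * ‖3 * ζ ^ 2 * s ^ 2 + 2 * α * ζ ^ 3 * s ^ 3‖ ^ 2
        + ‖4 * ζ ^ 3 * s ^ 2 + 2 * α * ζ ^ 4 * s ^ 3‖ ^ 2)
      + 2 * (‖α * s ^ 2‖ ^ 2 - 3 * ‖s + α * ζ * s ^ 2‖ ^ 2
        + 3 * ‖2 * ζ * s + α * ζ ^ 2 * s ^ 2‖ ^ 2
        - ‖3 * ζ ^ 2 * s + α * ζ ^ 3 * s ^ 2‖ ^ 2))
    ≤ (1 - ‖ζ‖ ^ 2) * (((2 - 2 * s ^ 3) *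
        (starRingEnd ℂ) (1 - (1 - (‖α‖ : ℂ) ^ 2) * s)).re - ‖α‖ ^ 2) := by
  have q : α * ζ * s = s - 1 := by linear_combination -hs
  have sh (c : ℝ) : ‖s + c‖ ^ 2 = ‖s‖ ^ 2 + 2 * c * s.re + c ^ 2 := by
    rw [nsq, nsq]; simp; ring
  have sh2 (c : ℝ) : ‖2 * s + c‖ ^ 2 = 4 * ‖s‖ ^ 2 + 4 * c * s.re + c ^ 2 := by
    rw [nsq, nsq]; simp; ring
  have e1 : s ^ 2 + 2 * α * ζ * s ^ 3 = s ^ 2 * (2 * s + ((-1 : ℝ) : ℂ)) := by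
    push_cast; linear_combination 2 * s ^ 2 * q
  have e2 : 2 * ζ * s ^ 2 + 2 * α * ζ ^ 2 * s ^ 3 = ζ * s ^ 2 * (2 * s + ((0 : ℝ) : ℂ)) := by
    push_cast; linear_combination 2 * s ^ 2 * ζ * q
  have e3 : 3 * ζ ^ 2 * s ^ 2 + 2 * α * ζ ^ 3 * s ^ 3
      = ζ ^ 2 * s ^ 2 * (2 * s + ((1 : ℝ) : ℂ)) := by
    push_cast; linear_combination 2 * s ^ 2 * ζ ^ 2 * q
  have e4 : 4 * ζ ^ 3 * s ^ 2 + 2 * α * ζ ^ 4 * s ^ 3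
      = ζ ^ 3 * s ^ 2 * (2 * s + ((2 : ℝ) : ℂ)) := by
    push_cast; linear_combination 2 * s ^ 2 * ζ ^ 3 * q
  have f1 : s + α * ζ * s ^ 2 = s * s := by linear_combination s * q
  have f2 : 2 * ζ * s + α * ζ ^ 2 * s ^ 2 = ζ * s * (s + ((1 : ℝ) : ℂ)) := by
    push_cast; linear_combination s * ζ * q
  have f3 : 3 * ζ ^ 2 * s + α * ζ ^ 3 * s ^ 2 = ζ ^ 2 * s * (s + ((2 : ℝ) : ℂ)) := by
    push_cast; linear_combination s * ζ ^ 2 * q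
  have hq : ‖α‖ ^ 2 * ‖ζ‖ ^ 2 * ‖s‖ ^ 2 = ‖s‖ ^ 2 - 2 * s.re + 1 := by
    have := sh (-1)
    rw [show s + ((-1 : ℝ) : ℂ) = α * ζ * s by rw [q]; push_cast; ring] at this
    rw [norm_mul, norm_mul] at this
    linarith
  have hu : s.re ^ 2 ≤ ‖s‖ ^ 2 := by rw [nsq]; nlinarith [sq_nonneg s.im]
  have main := alg_real (‖ζ‖ ^ 2) (‖s‖ ^ 2) s.re (‖α‖ ^ 2) (by positivity)
    (by nlinarith [norm_nonneg ζ]) (by positivity) (by positivity)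
    (by nlinarith [norm_nonneg α]) hu hq
  have hre : ((2 - 2 * s ^ 3) *
        (starRingEnd ℂ) (1 - (1 - (‖α‖ : ℂ) ^ 2) * s)).re
      = 2 - 2 * (1 - ‖α‖ ^ 2) * s.re - 2 * (4 * s.re ^ 3 - 3 * s.re * ‖s‖ ^ 2)
        + 2 * (1 - ‖α‖ ^ 2) * ‖s‖ ^ 2 * (2 * s.re ^ 2 - ‖s‖ ^ 2) := by
    rw [nsq s]
    rw [show (1 - (‖α‖ : ℂ) ^ 2) = ((1 - ‖α‖ ^ 2 : ℝ) : ℂ) by push_cast; ring]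
    simp only [pow_succ, pow_zero, one_mul, map_sub, map_mul, map_one, Complex.conj_ofReal]
    simp
    ring
  rw [hre, e1, e2, e3, e4, f1, f2, f3]
  simp only [norm_mul, mul_pow, norm_pow, sh, sh2, Complex.norm_ofNat]
  refine le_trans (le_of_eq ?_) main
  ring
end

section
open Topology Filter InnerProductSpace in
lemma lapR_congr {u v : ℂ → ℝ} {z : ℂ} (h : u =ᶠ[𝓝 z] v) : lapR u z = lapR v z := by
  unfold lapR
  have h1 (e : ℂ) : (fun w => fderiv ℝ u w e) =ᶠ[𝓝 z] (fun w => fderiv ℝ v w e) := by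
    filter_upwards [h.fderiv (𝕜 := ℝ)] with w hw
    rw [hw]
  rw [(h1 1).fderiv_eq, (h1 I).fderiv_eq]

lemma diff_fderiv_apply {u : ℂ → ℝ} {z : ℂ} (h : ContDiffAt ℝ 2 u z) (e : ℂ) :
    DifferentiableAt ℝ (fun w => fderiv ℝ u w e) z := by
  have : DifferentiableAt ℝ (fderiv ℝ u) z :=
    (h.fderiv_right (m := 1) (by norm_num)).differentiableAt (by norm_num)
  exact this.clm_apply (differentiableAt_const e)

open Topology Filter InnerProductSpace Laplacian in
lemma lapR_eq {u : ℂ → ℝ} {z : ℂ} (h : ContDiffAt ℝ 2 u z) : lapR u z = (1 / 4) * Δ u z := by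
  have : DifferentiableAt ℝ (fderiv ℝ u) z :=
    (h.fderiv_right (m := 1) (by norm_num)).differentiableAt (by norm_num)
  rw [laplacian_eq_iteratedFDeriv_complexPlane]
  simp only [iteratedFDeriv_two_apply, lapR]
  rw [fderiv_clm_apply this (by fun_prop), fderiv_clm_apply this (by fun_prop)]
  simp

open Topology Filter InnerProductSpace Laplacian in
lemma lapC_eq {u : ℂ → ℂ} {z : ℂ} (h : ContDiffAt ℝ 2 u z) : lapC u z = (1 / 4) * Δ u z := by
  have : DifferentiableAt ℝ (fderiv ℝ u) z :=
    (h.fderiv_right (m := 1) (by norm_num)).differentiableAt (by norm_num)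
  rw [laplacian_eq_iteratedFDeriv_complexPlane]
  simp only [iteratedFDeriv_two_apply, lapC]
  rw [fderiv_clm_apply this (by fun_prop), fderiv_clm_apply this (by fun_prop)]
  simp

lemma lapR_add {u v : ℂ → ℝ} {z : ℂ} (hu : ContDiffAt ℝ 2 u z) (hv : ContDiffAt ℝ 2 v z) :
    lapR (fun w => u w + v w) z = lapR u z + lapR v z := by
  rw [lapR_eq hu, lapR_eq hv, lapR_eq (hu.add hv)]
  have := ContDiffAt.laplacian_add hu hv
  rw [show (fun w => u w + v w) = u + v from rfl, this]; ring

lemma lapR_sub {u v : ℂ → ℝ} {z : ℂ} (hu : ContDiffAt ℝ 2 u z) (hv : ContDiffAt ℝ 2 v z) :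
    lapR (fun w => u w - v w) z = lapR u z - lapR v z := by
  rw [lapR_eq hu, lapR_eq hv, lapR_eq (hu.sub hv)]
  have := ContDiffAt.laplacian_sub hu hv
  rw [show (fun w => u w - v w) = u - v from rfl, this]; ring

lemma lapR_cmul {u : ℂ → ℝ} {z : ℂ} (c : ℝ) (hu : ContDiffAt ℝ 2 u z) :
    lapR (fun w => c * u w) z = c * lapR u z := by
  rw [lapR_eq hu, lapR_eq (contDiffAt_const.mul hu)]
  have := InnerProductSpace.laplacian_smul c hu
  rw [show (fun w => c * u w) = c • u from rfl, this]; simp; ring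

lemma lapR_const (c : ℝ) (z : ℂ) : lapR (fun _ => c) z = 0 := by
  simp [lapR]

open Topology Filter in
lemma ev_diff {u : ℂ → ℝ} {z : ℂ} (h : ContDiffAt ℝ 2 u z) :
    ∀ᶠ w in 𝓝 z, DifferentiableAt ℝ u w := by
  filter_upwards [h.eventually (by simp)] with w hw
  exact hw.differentiableAt (by norm_num)

open Topology Filter in
lemma lapR_mul {u v : ℂ → ℝ} {z : ℂ} (hu : ContDiffAt ℝ 2 u z) (hv : ContDiffAt ℝ 2 v z) :
    lapR (fun w => u w * v w) z = u z * lapR v z + v z * lapR u z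
      + (1 / 2) * (fderiv ℝ u z 1 * fderiv ℝ v z 1 + fderiv ℝ u z I * fderiv ℝ v z I) := by
  have h1 (e : ℂ) : (fun w => fderiv ℝ (fun w => u w * v w) w e) =ᶠ[𝓝 z]
      (fun w => u w * fderiv ℝ v w e + v w * fderiv ℝ u w e) := by
    filter_upwards [ev_diff hu, ev_diff hv] with w h1 h2
    rw [fderiv_fun_mul h1 h2]; simp
  have hud := (ev_diff hu).self_of_nhds
  have hvd := (ev_diff hv).self_of_nhds
  have h2 (e : ℂ) : fderiv ℝ (fun w => fderiv ℝ (fun w => u w * v w) w e) z e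
      = u z * fderiv ℝ (fun w => fderiv ℝ v w e) z e + v z * fderiv ℝ (fun w => fderiv ℝ u w e) z e
        + 2 * (fderiv ℝ u z e * fderiv ℝ v z e) := by
    have a1 := diff_fderiv_apply hu e
    have a2 := diff_fderiv_apply hv e
    rw [(h1 e).fderiv_eq, fderiv_fun_add (hud.fun_mul a2) (hvd.fun_mul a1), fderiv_fun_mul hud a2,
      fderiv_fun_mul hvd a1]
    simp; ring
  simp only [lapR, h2]; ring

open Topology Filter in
lemma lapR_comp {g : ℝ → ℝ} {u : ℂ → ℝ} {z : ℂ} (hg : ContDiffAt ℝ 2 g (u z))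
    (hu : ContDiffAt ℝ 2 u z) :
    lapR (fun w => g (u w)) z = deriv g (u z) * lapR u z
      + (1 / 4) * deriv (deriv g) (u z) * ((fderiv ℝ u z 1) ^ 2 + (fderiv ℝ u z I) ^ 2) := by
  have hud := (ev_diff hu).self_of_nhds
  have hgev : ∀ᶠ w in 𝓝 z, DifferentiableAt ℝ g (u w) := by
    have := hu.continuousAt.eventually (hg.eventually (by simp))
    filter_upwards [this] with w hw
    exact hw.differentiableAt (by norm_num)
  have h1 (e : ℂ) : (fun w => fderiv ℝ (fun w => g (u w)) w e) =ᶠ[𝓝 z]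
      (fun w => deriv g (u w) * fderiv ℝ u w e) := by
    filter_upwards [ev_diff hu, hgev] with w h1 h2
    have := (h2.hasDerivAt.comp_hasFDerivAt w h1.hasFDerivAt).fderiv
    have e1 : (g ∘ u) = fun w => g (u w) := rfl
    rw [e1] at this
    rw [this]; simp
  have hdg : DifferentiableAt ℝ (deriv g) (u z) := by
    have : DifferentiableAt ℝ (fderiv ℝ g) (u z) :=
      (hg.fderiv_right (m := 1) (by norm_num)).differentiableAt (by norm_num)
    exact this.clm_apply (differentiableAt_const 1)
  have h2 (e : ℂ) : fderiv ℝ (fun w => fderiv ℝ (fun w => g (u w)) w e) z e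
      = deriv g (u z) * fderiv ℝ (fun w => fderiv ℝ u w e) z e
        + deriv (deriv g) (u z) * (fderiv ℝ u z e) ^ 2 := by
    have a1 := diff_fderiv_apply hu e
    have a2 := hdg.hasDerivAt.comp_hasFDerivAt z hud.hasFDerivAt
    have a3 : HasFDerivAt (fun w => deriv g (u w)) (deriv (deriv g) (u z) • fderiv ℝ u z) z := a2
    rw [(h1 e).fderiv_eq, (a3.fun_mul a1.hasFDerivAt).fderiv]
    simp; ring
  simp only [lapR, h2]; ring

lemma lapR_harm {u : ℂ → ℝ} {z : ℂ} (h : InnerProductSpace.HarmonicAt u z) : lapR u z = 0 := by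
  rw [lapR_eq h.1, h.2.self_of_nhds]; simp

lemma fderiv_re {f : ℂ → ℂ} {z : ℂ} (hf : DifferentiableAt ℂ f z) (e : ℂ) :
    fderiv ℝ (fun w => (f w).re) z e = (deriv f z * e).re := by
  have h1 : HasFDerivAt f ((ContinuousLinearMap.toSpanSingleton ℂ (deriv f z)).restrictScalars ℝ) z :=
    hf.hasDerivAt.hasFDerivAt.restrictScalars ℝ
  have := (Complex.reCLM.hasFDerivAt.comp z h1).fderiv
  have e1 : (⇑Complex.reCLM ∘ f) = fun w => (f w).re := rfl
  rw [e1] at this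
  rw [this]; simp; ring

lemma fderiv_im {f : ℂ → ℂ} {z : ℂ} (hf : DifferentiableAt ℂ f z) (e : ℂ) :
    fderiv ℝ (fun w => (f w).im) z e = (deriv f z * e).im := by
  have h1 : HasFDerivAt f ((ContinuousLinearMap.toSpanSingleton ℂ (deriv f z)).restrictScalars ℝ) z :=
    hf.hasDerivAt.hasFDerivAt.restrictScalars ℝ
  have := (Complex.imCLM.hasFDerivAt.comp z h1).fderiv
  have e1 : (⇑Complex.imCLM ∘ f) = fun w => (f w).im := rfl
  rw [e1] at this
  rw [this]; simp; ring

lemma cd_re {f : ℂ → ℂ} {z : ℂ} (hf : AnalyticAt ℂ f z) : ContDiffAt ℝ 2 (fun w => (f w).re) z :=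
  hf.harmonicAt_re.1

lemma cd_im {f : ℂ → ℂ} {z : ℂ} (hf : AnalyticAt ℂ f z) : ContDiffAt ℝ 2 (fun w => (f w).im) z :=
  hf.harmonicAt_im.1

lemma cd_nsq {f : ℂ → ℂ} {z : ℂ} (hf : AnalyticAt ℂ f z) :
    ContDiffAt ℝ 2 (fun w => ‖f w‖ ^ 2) z := by
  simp only [nsq]
  exact ((cd_re hf).pow 2).add ((cd_im hf).pow 2)

lemma fderiv_nsq {f : ℂ → ℂ} {z : ℂ} (hf : AnalyticAt ℂ f z) (e : ℂ) :
    fderiv ℝ (fun w => ‖f w‖ ^ 2) z e = 2 * ((starRingEnd ℂ) (f z) * (deriv f z * e)).re := by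
  simp only [nsq]
  have h1 := (cd_re hf).differentiableAt (by norm_num)
  have h2 := (cd_im hf).differentiableAt (by norm_num)
  rw [fderiv_fun_add (h1.fun_pow 2) (h2.fun_pow 2), fderiv_fun_pow 2 h1, fderiv_fun_pow 2 h2]
  simp [fderiv_re hf.differentiableAt, fderiv_im hf.differentiableAt]
  ring

lemma lapR_nsq {f : ℂ → ℂ} {z : ℂ} (hf : AnalyticAt ℂ f z) :
    lapR (fun w => ‖f w‖ ^ 2) z = ‖deriv f z‖ ^ 2 := by
  simp only [nsq]
  simp only [pow_two]
  have h1 := cd_re hf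
  have h2 := cd_im hf
  have l1 : lapR (fun w => (f w).re) z = 0 := lapR_harm hf.harmonicAt_re
  have l2 : lapR (fun w => (f w).im) z = 0 := lapR_harm hf.harmonicAt_im
  rw [lapR_add (h1.mul h1) (h2.mul h2), lapR_mul h1 h1, lapR_mul h2 h2, l1, l2]
  simp [fderiv_re hf.differentiableAt, fderiv_im hf.differentiableAt]
  ring
end

section

lemma cd_fderiv_apply {u : ℂ → ℝ} (h : ContDiff ℝ 2 u) (e : ℂ) :
    ContDiff ℝ 1 (fun w => fderiv ℝ u w e) :=
  (h.fderiv_right (m := 1) (by norm_num)).clm_apply contDiff_const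

lemma cont_fderiv2 {u : ℂ → ℝ} (h : ContDiff ℝ 2 u) (e : ℂ) :
    Continuous (fun z => fderiv ℝ (fun w => fderiv ℝ u w e) z e) :=
  ((cd_fderiv_apply h e).continuous_fderiv (by norm_num)).clm_apply continuous_const

lemma cont_lapR {u : ℂ → ℝ} (h : ContDiff ℝ 2 u) : Continuous (lapR u) := by
  unfold lapR
  exact continuous_const.mul ((cont_fderiv2 h 1).add (cont_fderiv2 h I))

lemma ibp1 {f g : ℂ → ℝ} (hf : ContDiff ℝ 1 f) (hg : ContDiff ℝ 1 g)
    (hc : HasCompactSupport f ∨ HasCompactSupport g) (e : ℂ) :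
    ∫ x, f x * fderiv ℝ g x e = - ∫ x, fderiv ℝ f x e * g x := by
  have cf : Continuous (fun x => fderiv ℝ f x e) :=
    (hf.continuous_fderiv (by norm_num)).clm_apply continuous_const
  have cg : Continuous (fun x => fderiv ℝ g x e) :=
    (hg.continuous_fderiv (by norm_num)).clm_apply continuous_const
  refine integral_mul_fderiv_eq_neg_fderiv_mul_of_integrable ?_ ?_ ?_
    (fun x _ => hf.differentiable (by norm_num) x) (fun x _ => hg.differentiable (by norm_num) x)
  · apply (cf.mul hg.continuous).integrable_of_hasCompactSupport
    rcases hc with h | h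
    · exact (h.fderiv_apply (𝕜 := ℝ) e).mul_right
    · exact h.mul_left
  · apply (hf.continuous.mul cg).integrable_of_hasCompactSupport
    rcases hc with h | h
    · exact h.mul_right
    · exact (h.fderiv_apply (𝕜 := ℝ) e).mul_left
  · apply (hf.continuous.mul hg.continuous).integrable_of_hasCompactSupport
    rcases hc with h | h
    · exact h.mul_right
    · exact h.mul_left

lemma ibp2 {V W : ℂ → ℝ} (hV : ContDiff ℝ 2 V) (hc : HasCompactSupport V) (hW : ContDiff ℝ 2 W)
    (e : ℂ) : ∫ x, V x * fderiv ℝ (fun w => fderiv ℝ W w e) x e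
      = ∫ x, W x * fderiv ℝ (fun w => fderiv ℝ V w e) x e := by
  have hV1 : ContDiff ℝ 1 V := hV.of_le (by norm_num)
  have hW1 : ContDiff ℝ 1 W := hW.of_le (by norm_num)
  rw [ibp1 hV1 (cd_fderiv_apply hW e) (Or.inl hc) e,
    ibp1 hW1 (cd_fderiv_apply hV e) (Or.inr (hc.fderiv_apply (𝕜 := ℝ) e)) e]
  congr 1
  exact integral_congr_ae (Filter.Eventually.of_forall fun x => mul_comm _ _)

lemma ibp {V W : ℂ → ℝ} (hV : ContDiff ℝ 2 V) (hc : HasCompactSupport V) (hW : ContDiff ℝ 2 W) :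
    ∫ x, V x * lapR W x = ∫ x, W x * lapR V x := by
  have i1 (e : ℂ) : Integrable (fun x => V x * fderiv ℝ (fun w => fderiv ℝ W w e) x e) :=
    (hV.continuous.mul (cont_fderiv2 hW e)).integrable_of_hasCompactSupport hc.mul_right
  have i2 (e : ℂ) : Integrable (fun x => W x * fderiv ℝ (fun w => fderiv ℝ V w e) x e) :=
    (hW.continuous.mul (cont_fderiv2 hV e)).integrable_of_hasCompactSupport
      (((hc.fderiv_apply (𝕜 := ℝ) e).fderiv_apply (𝕜 := ℝ) e).mul_left)
  have e1 (A B : ℂ → ℝ) : (fun x => A x * lapR B x) = fun x =>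
      (1 / 4) * (A x * fderiv ℝ (fun w => fderiv ℝ B w 1) x 1
        + A x * fderiv ℝ (fun w => fderiv ℝ B w I) x I) := by
    funext x; unfold lapR; ring
  rw [e1, e1, integral_const_mul, integral_const_mul, integral_add (i1 1) (i1 I),
    integral_add (i2 1) (i2 I), ibp2 hV hc hW, ibp2 hV hc hW]

/-- positive part powers -/
def pp (n : ℕ) (x : ℝ) : ℝ := (max x 0) ^ n

lemma pp_cont (n : ℕ) : Continuous (pp n) := by unfold pp; fun_prop

lemma pp_deriv (n : ℕ) (x : ℝ) : HasDerivAt (pp (n + 2)) ((n + 2 : ℕ) * pp (n + 1) x) x := by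
  rcases lt_trichotomy x 0 with h | h | h
  · have : pp (n + 2) =ᶠ[nhds x] fun _ => 0 := by
      filter_upwards [gt_mem_nhds h] with y hy
      simp [pp, max_eq_right hy.le]
    have e : pp (n + 1) x = 0 := by simp [pp, max_eq_right h.le]
    rw [e, mul_zero]
    exact (hasDerivAt_const x (0:ℝ)).congr_of_eventuallyEq this
  · subst h
    have e : pp (n + 1) 0 = 0 := by simp [pp]
    rw [e, mul_zero, hasDerivAt_iff_isLittleO]
    have h1 : (fun x' : ℝ => pp (n + 2) x' - pp (n + 2) 0 - (x' - 0) • (0:ℝ)) = pp (n + 2) := by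
      funext y; simp [pp]
    rw [h1]
    refine Asymptotics.IsBigO.trans_isLittleO (g := fun x : ℝ => x ^ (n + 2)) ?_ ?_
    · refine Asymptotics.IsBigO.of_bound 1 (Filter.Eventually.of_forall fun y => ?_)
      simp only [pp, norm_pow, Real.norm_eq_abs, one_mul]
      refine pow_le_pow_left₀ (abs_nonneg _) ?_ _
      rw [abs_of_nonneg (le_max_right _ _)]
      exact max_le (le_abs_self y) (abs_nonneg y)
    · simpa using Asymptotics.isLittleO_pow_id (𝕜 := ℝ) (n := n + 2) (by omega)
  · have : pp (n + 2) =ᶠ[nhds x] fun y => y ^ (n + 2) := by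
      filter_upwards [lt_mem_nhds h] with y hy
      simp [pp, max_eq_left hy.le]
    have e : pp (n + 1) x = x ^ (n + 1) := by simp [pp, max_eq_left h.le]
    rw [e]
    exact (hasDerivAt_pow (n + 2) x).congr_of_eventuallyEq this

lemma pp_cd1 (n : ℕ) : ContDiff ℝ 1 (pp (n + 2)) := by
  rw [contDiff_one_iff_deriv]
  refine ⟨fun x => (pp_deriv n x).differentiableAt, ?_⟩
  have : deriv (pp (n + 2)) = fun x => ((n + 2 : ℕ) : ℝ) * pp (n + 1) x :=
    funext fun x => (pp_deriv n x).deriv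
  rw [this]
  exact continuous_const.mul (pp_cont _)

lemma pp_cd2 (n : ℕ) : ContDiff ℝ 2 (pp (n + 3)) := by
  rw [show (2 : WithTop ℕ∞) = 1 + 1 by norm_num, contDiff_succ_iff_deriv]
  refine ⟨fun x => (pp_deriv (n + 1) x).differentiableAt, by simp, ?_⟩
  have : deriv (pp (n + 3)) = fun x => ((n + 1 + 2 : ℕ) : ℝ) * pp (n + 2) x :=
    funext fun x => (pp_deriv (n + 1) x).deriv
  rw [this]
  exact contDiff_const.mul (pp_cd1 n)
end

section

open Topology Filter in
lemma lapR_scale (u : ℂ → ℝ) (r : ℝ) (z : ℂ) :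
    lapR (fun w => u (r • w)) z = r ^ 2 * lapR u (r • z) := by
  have h1 (e : ℂ) : (fun w => fderiv ℝ (fun w => u (r • w)) w e)
      = fun w => r * fderiv ℝ u (r • w) e := by
    funext w
    rw [fderiv_comp_smul]; simp
  have h2 (e : ℂ) : fderiv ℝ (fun w => fderiv ℝ (fun w => u (r • w)) w e) z e
      = r ^ 2 * fderiv ℝ (fun w => fderiv ℝ u w e) (r • z) e := by
    rw [h1]
    have := fderiv_comp_smul (𝕜 := ℝ) (f := fun w => fderiv ℝ u w e) (c := r) (x := z)
    rw [show (fun w => r * fderiv ℝ u (r • w) e) = r • (fun w => fderiv ℝ u (r • w) e) from rfl,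
      fderiv_const_smul_field, Pi.smul_apply, this]
    simp; ring
  unfold lapR
  simp only [h2]; ring

lemma oneSub_pos {z : ℂ} (hz : ‖z‖ < 1) : 0 < 1 - ‖z‖ ^ 2 := by
  nlinarith [norm_nonneg z]

lemma cd_P (z : ℂ) : ContDiffAt ℝ 2 (fun w : ℂ => 1 - ‖w‖ ^ 2) z :=
  contDiffAt_const.sub (cd_nsq analyticAt_id)

lemma lap_P (z : ℂ) : lapR (fun w : ℂ => 1 - ‖w‖ ^ 2) z = -1 := by
  have := lapR_sub (u := fun _ => 1) (v := fun w : ℂ => ‖w‖ ^ 2) (z := z) contDiffAt_const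
    (cd_nsq analyticAt_id)
  rw [this, lapR_const]
  have h := lapR_nsq (f := fun w => w) (z := z) analyticAt_id
  rw [h]; simp

lemma fderiv_P (z e : ℂ) :
    fderiv ℝ (fun w : ℂ => 1 - ‖w‖ ^ 2) z e = - (2 * ((starRingEnd ℂ) z * e).re) := by
  have h := fderiv_nsq (f := fun w => w) (z := z) analyticAt_id e
  rw [fderiv_const_sub]
  simp only [neg_apply, h]; simp

lemma lap_logP {z : ℂ} (hz : ‖z‖ < 1) :
    lapR (fun w : ℂ => Real.log (1 - ‖w‖ ^ 2)) z = - (1 / (1 - ‖z‖ ^ 2) ^ 2) := by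
  have hp := oneSub_pos hz
  rw [lapR_comp (g := Real.log) (u := fun w : ℂ => 1 - ‖w‖ ^ 2)
    (Real.contDiffAt_log.2 hp.ne') (cd_P z), lap_P, fderiv_P, fderiv_P]
  have h2 : deriv (deriv Real.log) (1 - ‖z‖ ^ 2) = - ((1 - ‖z‖ ^ 2) ^ 2)⁻¹ := by
    rw [Real.deriv_log']; simp
  rw [h2, Real.deriv_log]
  have : ((starRingEnd ℂ) z * 1).re ^ 2 + ((starRingEnd ℂ) z * I).re ^ 2 = ‖z‖ ^ 2 := by
    rw [nsq]; simp
  have h4 : (-(2 * ((starRingEnd ℂ) z * 1).re)) ^ 2 + (-(2 * ((starRingEnd ℂ) z * I).re)) ^ 2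
    = 4 * ‖z‖ ^ 2 := by rw [← this]; ring
  rw [h4]
  field_simp
  ring

/-- the subharmonic function -/
def Ufun (φ : ℂ → ℝ) (F : ℂ → ℂ) (z : ℂ) : ℝ := Real.exp (φ z) * ‖F z‖ ^ 2 / (1 - ‖z‖ ^ 2)

lemma U_cd {φ : ℂ → ℝ} {F : ℂ → ℂ} {z : ℂ} (hφ : ContDiffAt ℝ 2 φ z) (hF : AnalyticAt ℂ F z)
    (hz : ‖z‖ < 1) : ContDiffAt ℝ 2 (Ufun φ F) z :=
  (hφ.exp.mul (cd_nsq hF)).div (cd_P z) (oneSub_pos hz).ne'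

open Topology Filter in
lemma U_sub {φ : ℂ → ℝ} {F : ℂ → ℂ} {z : ℂ} (hφ : ContDiffAt ℝ 2 φ z) (hF : AnalyticAt ℂ F z)
    (hz : ‖z‖ < 1) (hl : - (1 / (1 - ‖z‖ ^ 2) ^ 2) ≤ lapR φ z) : 0 ≤ lapR (Ufun φ F) z := by
  have hp := oneSub_pos hz
  have hlog : ContDiffAt ℝ 2 (fun w : ℂ => Real.log (1 - ‖w‖ ^ 2)) z := (cd_P z).log hp.ne'
  set ψ : ℂ → ℝ := fun w => φ w - Real.log (1 - ‖w‖ ^ 2) with hψ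
  have cψ : ContDiffAt ℝ 2 ψ z := hφ.sub hlog
  have lψ : 0 ≤ lapR ψ z := by
    rw [hψ, lapR_sub hφ hlog, lap_logP hz]; linarith
  have e : Ufun φ F =ᶠ[𝓝 z] fun w => Real.exp (ψ w) * ‖F w‖ ^ 2 := by
    have : ∀ᶠ w : ℂ in 𝓝 z, ‖w‖ < 1 := (continuous_norm.tendsto z).eventually (gt_mem_nhds hz)
    filter_upwards [this] with w hw
    rw [hψ]; simp only
    rw [Real.exp_sub, Real.exp_log (oneSub_pos hw), Ufun]; ring
  have ce : ContDiffAt ℝ 2 (fun w => Real.exp (ψ w)) z := cψ.exp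
  have le : lapR (fun w => Real.exp (ψ w)) z = Real.exp (ψ z) * lapR ψ z
      + (1 / 4) * Real.exp (ψ z) * ((fderiv ℝ ψ z 1) ^ 2 + (fderiv ℝ ψ z I) ^ 2) := by
    rw [lapR_comp (g := Real.exp) Real.contDiff_exp.contDiffAt cψ]; simp
  have fe (v : ℂ) : fderiv ℝ (fun w => Real.exp (ψ w)) z v = Real.exp (ψ z) * fderiv ℝ ψ z v := by
    rw [fderiv_exp (cψ.differentiableAt (by norm_num))]; simp
  rw [lapR_congr e, lapR_mul ce (cd_nsq hF), le, lapR_nsq hF, fe, fe, fderiv_nsq hF, fderiv_nsq hF]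
  set p := fderiv ℝ ψ z 1
  set q := fderiv ℝ ψ z I
  have key : Real.exp (ψ z) * ‖deriv F z‖ ^ 2 + ‖F z‖ ^ 2 * (Real.exp (ψ z) * lapR ψ z
      + 1 / 4 * Real.exp (ψ z) * (p ^ 2 + q ^ 2)) + 1 / 2 * (Real.exp (ψ z) * p *
        (2 * ((starRingEnd ℂ) (F z) * (deriv F z * 1)).re) + Real.exp (ψ z) * q *
        (2 * ((starRingEnd ℂ) (F z) * (deriv F z * I)).re))
      = Real.exp (ψ z) * (‖F z‖ ^ 2 * lapR ψ z
        + (((deriv F z).re + ((F z).re * p + (F z).im * q) / 2) ^ 2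
        + ((deriv F z).im + ((F z).im * p - (F z).re * q) / 2) ^ 2)) := by
    rw [nsq, nsq]; simp; ring
  rw [key]
  positivity
end

section

/-- denominators -/
def Dw (w z : ℂ) : ℂ := 1 - (starRingEnd ℂ) w * z
def Ef (w α z : ℂ) : ℂ := Dw w z - α * (z - w)
def sf (w α z : ℂ) : ℂ := Dw w z / Ef w α z
def bf (w z : ℂ) : ℂ := (z - w) / Dw w z
def Wf (w α z : ℂ) : ℝ :=
  (‖α‖ ^ 2 / 4) * (pp 4 (1 - ‖z‖ ^ 2) * ((1 - ‖w‖ ^ 2) ^ 4 * ‖1 / (Dw w z ^ 2 * Ef w α z ^ 2)‖ ^ 2)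
    + 2 * (pp 3 (1 - ‖z‖ ^ 2) * ((1 - ‖w‖ ^ 2) ^ 3 * ‖1 / (Dw w z ^ 2 * Ef w α z)‖ ^ 2)))
def Xf (w α z : ℂ) : ℝ :=
  ((2 - 2 * sf w α z ^ 3) * (starRingEnd ℂ) (1 - (1 - (‖α‖ : ℂ) ^ 2) * sf w α z)).re - ‖α‖ ^ 2

lemma moebius_id (w z : ℂ) :
    ‖Dw w z‖ ^ 2 - ‖z - w‖ ^ 2 = (1 - ‖z‖ ^ 2) * (1 - ‖w‖ ^ 2) := by
  rw [Dw, nsq, nsq, nsq, nsq]; simp; ring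

lemma Dw_ge {w z : ℂ} (hz : ‖z‖ ≤ 1) : 1 - ‖w‖ ≤ ‖Dw w z‖ := by
  have h1 : ‖(starRingEnd ℂ) w * z‖ ≤ ‖w‖ := by
    rw [norm_mul, RCLike.norm_conj]
    exact mul_le_of_le_one_right (norm_nonneg _) hz
  have h2 := norm_sub_norm_le (1 : ℂ) ((starRingEnd ℂ) w * z)
  rw [norm_one] at h2
  unfold Dw; linarith

lemma Dw_le {w z : ℂ} (hw : ‖w‖ < 1) (hz : ‖z‖ ≤ 1) : ‖Dw w z‖ ≤ 2 := by
  have h1 : ‖(starRingEnd ℂ) w * z‖ ≤ ‖w‖ := by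
    rw [norm_mul, RCLike.norm_conj]
    exact mul_le_of_le_one_right (norm_nonneg _) hz
  have h2 := norm_sub_le (1 : ℂ) ((starRingEnd ℂ) w * z)
  rw [norm_one] at h2
  unfold Dw; linarith

lemma Dw_ne {w z : ℂ} (hw : ‖w‖ < 1) (hz : ‖z‖ ≤ 1) : Dw w z ≠ 0 := by
  have := Dw_ge (w := w) hz
  exact norm_pos_iff.1 (by linarith)

lemma zw_le {w z : ℂ} (hw : ‖w‖ < 1) (hz : ‖z‖ ≤ 1) : ‖z - w‖ ≤ ‖Dw w z‖ := by
  have h := moebius_id w z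
  have h1 : 0 ≤ (1 - ‖z‖ ^ 2) * (1 - ‖w‖ ^ 2) :=
    mul_nonneg (by nlinarith [norm_nonneg z]) (by nlinarith [norm_nonneg w])
  exact abs_le_of_sq_le_sq' (by linarith) (norm_nonneg _) |>.2

lemma Ef_ge {w α z : ℂ} (hw : ‖w‖ < 1) (hz : ‖z‖ ≤ 1) :
    (1 - ‖α‖) * ‖Dw w z‖ ≤ ‖Ef w α z‖ := by
  have h1 : ‖α * (z - w)‖ ≤ ‖α‖ * ‖Dw w z‖ := by
    rw [norm_mul]; exact mul_le_mul_of_nonneg_left (zw_le hw hz) (norm_nonneg _)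
  have h2 := norm_sub_norm_le (Dw w z) (α * (z - w))
  unfold Ef; linarith

lemma Ef_ne {w α z : ℂ} (hw : ‖w‖ < 1) (hα : ‖α‖ < 1) (hz : ‖z‖ ≤ 1) : Ef w α z ≠ 0 := by
  have := Ef_ge (α := α) hw hz
  have h2 : 0 < (1 - ‖α‖) * ‖Dw w z‖ := mul_pos (by linarith) (norm_pos_iff.2 (Dw_ne hw hz))
  exact norm_pos_iff.1 (by linarith)

lemma sf_le {w α z : ℂ} (hw : ‖w‖ < 1) (hα : ‖α‖ < 1) (hz : ‖z‖ ≤ 1) :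
    ‖sf w α z‖ ≤ 1 / (1 - ‖α‖) := by
  rw [sf, norm_div, div_le_div_iff₀ (norm_pos_iff.2 (Ef_ne hw hα hz)) (by linarith)]
  linarith [Ef_ge (α := α) hw hz]

lemma sf_mul {w α z : ℂ} (hw : ‖w‖ < 1) (hα : ‖α‖ < 1) (hz : ‖z‖ ≤ 1) :
    sf w α z * (1 - α * bf w z) = 1 := by
  have h1 := Dw_ne hw hz
  have h2 := Ef_ne hw hα hz
  have e : 1 - α * bf w z = Ef w α z / Dw w z := by
    rw [bf, Ef]; field_simp
  rw [e, sf]; field_simp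

lemma bf_id {w z : ℂ} (hw : ‖w‖ < 1) (hz : ‖z‖ ≤ 1) :
    1 - ‖bf w z‖ ^ 2 = (1 - ‖z‖ ^ 2) * (1 - ‖w‖ ^ 2) / ‖Dw w z‖ ^ 2 := by
  have h1 : ‖Dw w z‖ ≠ 0 := norm_ne_zero_iff.2 (Dw_ne hw hz)
  rw [← moebius_id, bf, norm_div]; field_simp

lemma bf_lt {w z : ℂ} (hw : ‖w‖ < 1) (hz : ‖z‖ < 1) : ‖bf w z‖ < 1 := by
  have h := bf_id hw hz.le
  have h1 : 0 < ‖Dw w z‖ := norm_pos_iff.2 (Dw_ne hw hz.le)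
  have h2 := oneSub_pos hz
  have h3 := oneSub_pos hw
  have h4 : 0 < 1 - ‖bf w z‖ ^ 2 := by rw [h]; positivity
  nlinarith [norm_nonneg (bf w z)]

lemma Dw_an (w z : ℂ) : AnalyticAt ℂ (Dw w) z := by unfold Dw; fun_prop
lemma Ef_an (w α z : ℂ) : AnalyticAt ℂ (Ef w α) z := by unfold Ef Dw; fun_prop

lemma Wf_cd {w α : ℂ} (hw : ‖w‖ < 1) (hα : ‖α‖ < 1) : ContDiff ℝ 2 (Wf w α) := by
  rw [contDiff_iff_contDiffAt]
  intro z
  by_cases hz : ‖z‖ ≤ 1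
  · have h1 := Dw_ne hw hz
    have h2 := Ef_ne hw hα hz
    have a1 := Dw_an w z
    have a2 := Ef_an w α z
    have c1 := cd_nsq (f := fun z => 1 / (Dw w z ^ 2 * Ef w α z ^ 2)) (z := z)
      (analyticAt_const.div ((a1.pow 2).mul (a2.pow 2)) (by simp [h1, h2]))
    have c2 := cd_nsq (f := fun z => 1 / (Dw w z ^ 2 * Ef w α z)) (z := z)
      (analyticAt_const.div ((a1.pow 2).mul a2) (by simp [h1, h2]))
    have p4 : ContDiffAt ℝ 2 (fun z : ℂ => pp 4 (1 - ‖z‖ ^ 2)) z :=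
      (pp_cd2 1).contDiffAt.comp z (cd_P z)
    have p3 : ContDiffAt ℝ 2 (fun z : ℂ => pp 3 (1 - ‖z‖ ^ 2)) z :=
      (pp_cd2 0).contDiffAt.comp z (cd_P z)
    exact contDiffAt_const.mul ((p4.mul (contDiffAt_const.mul c1)).add
      (contDiffAt_const.mul (p3.mul (contDiffAt_const.mul c2))))
  · push Not at hz
    have : Wf w α =ᶠ[nhds z] fun _ => 0 := by
      filter_upwards [(continuous_norm.tendsto z).eventually (lt_mem_nhds hz)] with y hy
      have : 1 - ‖y‖ ^ 2 ≤ 0 := by nlinarith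
      simp [Wf, pp, max_eq_right this]
    exact contDiffAt_const.congr_of_eventuallyEq this

lemma Wf_nonneg (w α z : ℂ) (hw : ‖w‖ < 1) : 0 ≤ Wf w α z := by
  have := oneSub_pos hw
  unfold Wf pp; positivity

lemma Wf_zero {w α z : ℂ} (hz : 1 ≤ ‖z‖) : Wf w α z = 0 := by
  have : 1 - ‖z‖ ^ 2 ≤ 0 := by nlinarith
  simp [Wf, pp, max_eq_right this]

lemma sf_an {w α z : ℂ} (hw : ‖w‖ < 1) (hα : ‖α‖ < 1) (hz : ‖z‖ ≤ 1) :
    AnalyticAt ℂ (sf w α) z := (Dw_an w z).div (Ef_an w α z) (Ef_ne hw hα hz)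

lemma bf_an {w z : ℂ} (hw : ‖w‖ < 1) (hz : ‖z‖ ≤ 1) :
    AnalyticAt ℂ (bf w) z := (by fun_prop : AnalyticAt ℂ (fun z => z - w) z).div (Dw_an w z)
      (Dw_ne hw hz)

lemma bf_deriv {w z : ℂ} (hw : ‖w‖ < 1) (hz : ‖z‖ ≤ 1) :
    HasDerivAt (bf w) ((1 - ‖w‖ ^ 2 : ℝ) / Dw w z ^ 2) z := by
  have h1 : HasDerivAt (Dw w) (-(starRingEnd ℂ) w) z := by
    have := ((hasDerivAt_id z).const_mul ((starRingEnd ℂ) w)).const_sub 1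
    rw [mul_one] at this
    exact this
  have h2 := ((hasDerivAt_id z).sub_const w).div h1 (Dw_ne hw hz)
  refine h2.congr_deriv ?_
  congr 1
  have : (w * (starRingEnd ℂ) w) = (‖w‖ : ℂ) ^ 2 := by
    rw [Complex.mul_conj, Complex.normSq_eq_norm_sq]; push_cast; ring
  push_cast
  rw [← this]
  unfold Dw; simp; ring

lemma sf_deriv {w α z : ℂ} (hw : ‖w‖ < 1) (hα : ‖α‖ < 1) (hz : ‖z‖ < 1) :
    HasDerivAt (sf w α) (α * ((1 - ‖w‖ ^ 2 : ℝ) / Dw w z ^ 2) * sf w α z ^ 2) z := by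
  have hb := bf_deriv hw hz.le
  have hne : 1 - α * bf w z ≠ 0 := right_ne_zero_of_mul_eq_one (sf_mul hw hα hz.le)
  have h := ((hb.const_mul α).const_sub 1).inv hne
  have e : sf w α =ᶠ[nhds z] fun y => (1 - α * bf w y)⁻¹ := by
    filter_upwards [(continuous_norm.tendsto z).eventually (gt_mem_nhds hz)] with y hy
    exact eq_inv_of_mul_eq_one_left (sf_mul hw hα hy.le)
  refine (h.congr_of_eventuallyEq e).congr_deriv ?_
  rw [e.self_of_nhds]; field_simp

open Topology Filter in
lemma Wf_lap {w α z : ℂ} (hw : ‖w‖ < 1) (hα : ‖α‖ < 1) (hz : ‖z‖ < 1) :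
    lapR (Wf w α) z ≤ (1 - ‖w‖ ^ 2) ^ 3 / ‖Dw w z‖ ^ 6 * ((1 - ‖z‖ ^ 2) * Xf w α z) := by
  set b := bf w with hb
  set s := sf w α with hs
  have e : Wf w α =ᶠ[𝓝 z] fun y => (‖α‖ ^ 2 / 4) *
      (((‖s y ^ 2‖ ^ 2 - 4 * ‖b y * s y ^ 2‖ ^ 2) + (6 * ‖b y ^ 2 * s y ^ 2‖ ^ 2
        - 4 * ‖b y ^ 3 * s y ^ 2‖ ^ 2) + ‖b y ^ 4 * s y ^ 2‖ ^ 2)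
      + 2 * ((‖s y‖ ^ 2 - 3 * ‖b y * s y‖ ^ 2) + (3 * ‖b y ^ 2 * s y‖ ^ 2
        - ‖b y ^ 3 * s y‖ ^ 2))) := by
    filter_upwards [(continuous_norm.tendsto z).eventually (gt_mem_nhds hz)] with y hy
    have hp := oneSub_pos hy
    have h1 : ‖Dw w y‖ ≠ 0 := norm_ne_zero_iff.2 (Dw_ne hw hy.le)
    have h2 : ‖Ef w α y‖ ≠ 0 := norm_ne_zero_iff.2 (Ef_ne hw hα hy.le)
    have hid : ‖b y‖ ^ 2 = 1 - (1 - ‖y‖ ^ 2) * (1 - ‖w‖ ^ 2) / ‖Dw w y‖ ^ 2 := by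
      rw [← bf_id hw hy.le]; ring
    have hs2 : ‖s y‖ ^ 2 = ‖Dw w y‖ ^ 2 / ‖Ef w α y‖ ^ 2 := by rw [hs, sf, norm_div, div_pow]
    have q1 : ‖s y ^ 2‖ ^ 2 = (‖s y‖ ^ 2) ^ 2 := by rw [norm_pow]
    have q2 (k : ℕ) : ‖b y ^ k‖ ^ 2 = (‖b y‖ ^ 2) ^ k := by rw [norm_pow]; ring
    simp only [norm_mul, mul_pow, q1, q2, hid, hs2]
    simp only [Wf, pp, max_eq_left hp.le, norm_div, norm_one, norm_mul, norm_pow]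
    field_simp
    ring
  rw [lapR_congr e]
  have hba : AnalyticAt ℂ b z := bf_an hw hz.le
  have hsa : AnalyticAt ℂ s z := sf_an hw hα hz.le
  set b' : ℂ := (1 - ‖w‖ ^ 2 : ℝ) / Dw w z ^ 2 with hb'
  have db : HasDerivAt b b' z := bf_deriv hw hz.le
  have ds : HasDerivAt s (α * b' * s z ^ 2) z := sf_deriv hw hα hz
  have g0 := cd_nsq (f := fun y => s y ^ 2) (hsa.pow 2)
  have g1 := cd_nsq (f := fun y => b y * s y ^ 2) (hba.mul (hsa.pow 2))
  have g2 := cd_nsq (f := fun y => b y ^ 2 * s y ^ 2) ((hba.pow 2).mul (hsa.pow 2))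
  have g3 := cd_nsq (f := fun y => b y ^ 3 * s y ^ 2) ((hba.pow 3).mul (hsa.pow 2))
  have g4 := cd_nsq (f := fun y => b y ^ 4 * s y ^ 2) ((hba.pow 4).mul (hsa.pow 2))
  have k0 := cd_nsq (f := fun y => s y) hsa
  have k1 := cd_nsq (f := fun y => b y * s y) (hba.mul hsa)
  have k2 := cd_nsq (f := fun y => b y ^ 2 * s y) ((hba.pow 2).mul hsa)
  have k3 := cd_nsq (f := fun y => b y ^ 3 * s y) ((hba.pow 3).mul hsa)
  have G0 := lapR_nsq (f := fun y => s y ^ 2) (hsa.pow 2)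
  have G1 := lapR_nsq (f := fun y => b y * s y ^ 2) (hba.mul (hsa.pow 2))
  have G2 := lapR_nsq (f := fun y => b y ^ 2 * s y ^ 2) ((hba.pow 2).mul (hsa.pow 2))
  have G3 := lapR_nsq (f := fun y => b y ^ 3 * s y ^ 2) ((hba.pow 3).mul (hsa.pow 2))
  have G4 := lapR_nsq (f := fun y => b y ^ 4 * s y ^ 2) ((hba.pow 4).mul (hsa.pow 2))
  have K0 := lapR_nsq (f := fun y => s y) hsa
  have K1 := lapR_nsq (f := fun y => b y * s y) (hba.mul hsa)
  have K2 := lapR_nsq (f := fun y => b y ^ 2 * s y) ((hba.pow 2).mul hsa)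
  have K3 := lapR_nsq (f := fun y => b y ^ 3 * s y) ((hba.pow 3).mul hsa)
  have c {u : ℂ → ℝ} (t : ℝ) (h : ContDiffAt ℝ 2 u z) : ContDiffAt ℝ 2 (fun y => t * u y) z :=
    contDiffAt_const.mul h
  have m1 := g0.sub (c 4 g1)
  have m2 := (c 6 g2).sub (c 4 g3)
  have n1 := k0.sub (c 3 k1)
  have n2 := (c 3 k2).sub k3
  rw [lapR_cmul _ (((m1.add m2).add g4).add (c 2 (n1.add n2))),
    lapR_add ((m1.add m2).add g4) (c 2 (n1.add n2)), lapR_cmul _ (n1.add n2), lapR_add n1 n2,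
    lapR_add (m1.add m2) g4, lapR_add m1 m2, lapR_sub g0 (c 4 g1), lapR_sub (c 6 g2) (c 4 g3),
    lapR_sub k0 (c 3 k1), lapR_sub (c 3 k2) k3, lapR_cmul 4 g1, lapR_cmul 6 g2, lapR_cmul 4 g3,
    lapR_cmul 3 k1, lapR_cmul 3 k2, G0, G1, G2, G3, G4, K0, K1, K2, K3]
  have D0 : deriv (fun y => s y ^ 2) z = (2 * α * s z ^ 3) * b' := by
    rw [(ds.fun_pow 2).deriv]; push_cast; ring
  have D1 : deriv (fun y => b y * s y ^ 2) z = (s z ^ 2 + 2 * α * b z * s z ^ 3) * b' := by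
    rw [(db.fun_mul (ds.fun_pow 2)).deriv]; push_cast; ring
  have D2 : deriv (fun y => b y ^ 2 * s y ^ 2) z
      = (2 * b z * s z ^ 2 + 2 * α * b z ^ 2 * s z ^ 3) * b' := by
    rw [((db.fun_pow 2).fun_mul (ds.fun_pow 2)).deriv]; push_cast; ring
  have D3 : deriv (fun y => b y ^ 3 * s y ^ 2) z
      = (3 * b z ^ 2 * s z ^ 2 + 2 * α * b z ^ 3 * s z ^ 3) * b' := by
    rw [((db.fun_pow 3).fun_mul (ds.fun_pow 2)).deriv]; push_cast; ring
  have D4 : deriv (fun y => b y ^ 4 * s y ^ 2) z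
      = (4 * b z ^ 3 * s z ^ 2 + 2 * α * b z ^ 4 * s z ^ 3) * b' := by
    rw [((db.fun_pow 4).fun_mul (ds.fun_pow 2)).deriv]; push_cast; ring
  have F0 : deriv (fun y => s y) z = (α * s z ^ 2) * b' := by
    rw [ds.deriv]; ring
  have F1 : deriv (fun y => b y * s y) z = (s z + α * b z * s z ^ 2) * b' := by
    rw [(db.fun_mul ds).deriv]; ring
  have F2 : deriv (fun y => b y ^ 2 * s y) z
      = (2 * b z * s z + α * b z ^ 2 * s z ^ 2) * b' := by
    rw [((db.fun_pow 2).fun_mul ds).deriv]; push_cast; ring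
  have F3 : deriv (fun y => b y ^ 3 * s y) z
      = (3 * b z ^ 2 * s z + α * b z ^ 3 * s z ^ 2) * b' := by
    rw [((db.fun_pow 3).fun_mul ds).deriv]; push_cast; ring
  rw [D0, D1, D2, D3, D4, F0, F1, F2, F3]
  simp only [norm_mul _ b', mul_pow _ ‖b'‖ 2]
  have main := alg_cplx (b z) α (s z) (bf_lt hw hz) hα (sf_mul hw hα hz.le)
  have h1 : ‖Dw w z‖ ≠ 0 := norm_ne_zero_iff.2 (Dw_ne hw hz.le)
  have hbn : ‖b'‖ ^ 2 = (1 - ‖w‖ ^ 2) ^ 2 / ‖Dw w z‖ ^ 4 := by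
    rw [hb', norm_div, Complex.norm_real, Real.norm_of_nonneg (oneSub_pos hw).le, norm_pow]
    field_simp
  have main2 := mul_le_mul_of_nonneg_left main (sq_nonneg ‖b'‖)
  refine le_trans (le_of_eq ?_) (main2.trans (le_of_eq ?_))
  · ring
  · have hX : ((2 - 2 * s z ^ 3) * (starRingEnd ℂ) (1 - (1 - (‖α‖ : ℂ) ^ 2) * s z)).re - ‖α‖ ^ 2
        = Xf w α z := rfl
    rw [bf_id hw hz.le, hbn, hX]
    field_simp
end

section

lemma sf_cont {w α : ℂ} (hw : ‖w‖ < 1) (hα : ‖α‖ < 1) :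
    ContinuousOn (sf w α) (closedBall 0 1) := fun z hz =>
  (sf_an hw hα (by simpa using hz)).continuousAt.continuousWithinAt

lemma Xf_cont {w α : ℂ} (hw : ‖w‖ < 1) (hα : ‖α‖ < 1) :
    ContinuousOn (Xf w α) (closedBall 0 1) := by
  have := sf_cont hw hα
  unfold Xf
  refine ContinuousOn.sub ?_ continuousOn_const
  refine Complex.continuous_re.comp_continuousOn ?_
  refine ContinuousOn.mul (continuousOn_const.sub (continuousOn_const.mul (this.pow 3))) ?_
  exact Complex.continuous_conj.comp_continuousOn
    (continuousOn_const.sub (continuousOn_const.mul this))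

lemma Y_cont {w α : ℂ} (hw : ‖w‖ < 1) (hα : ‖α‖ < 1) :
    ContinuousOn (fun z => (1 - ‖w‖ ^ 2) ^ 3 / ‖Dw w z‖ ^ 6 * Xf w α z) (closedBall 0 1) := by
  refine ContinuousOn.mul (ContinuousOn.div continuousOn_const ?_ ?_) (Xf_cont hw hα)
  · have : Continuous (Dw w) := by unfold Dw; fun_prop
    exact (this.norm.pow 6).continuousOn
  · intro z hz
    exact pow_ne_zero _ (norm_ne_zero_iff.2 (Dw_ne hw (by simpa using hz)))

open Topology Filter in
lemma main_r {φ : ℂ → ℝ} {F : ℂ → ℂ} (hφ : ∀ z ∈ ball (0 : ℂ) 1, ContDiffAt ℝ 2 φ z)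
    (hl : ∀ z ∈ ball (0 : ℂ) 1, - (1 / (1 - ‖z‖ ^ 2) ^ 2) ≤ lapR φ z)
    (hF : DifferentiableOn ℂ F (ball 0 1)) {w α : ℂ} (hw : ‖w‖ < 1) (hα : ‖α‖ < 1)
    {r : ℝ} (hr0 : 0 < r) (hr1 : r < 1) :
    IntegrableOn (fun z => Ufun φ F (r • z) *
      ((1 - ‖w‖ ^ 2) ^ 3 / ‖Dw w z‖ ^ 6 * Xf w α z * (1 - ‖z‖ ^ 2))) (ball 0 1) ∧
    0 ≤ ∫ z in ball (0 : ℂ) 1, Ufun φ F (r • z) *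
      ((1 - ‖w‖ ^ 2) ^ 3 / ‖Dw w z‖ ^ 6 * Xf w α z * (1 - ‖z‖ ^ 2)) := by
  have hFa : ∀ z ∈ ball (0 : ℂ) 1, AnalyticAt ℂ F z := fun z hz =>
    hF.analyticAt (isOpen_ball.mem_nhds hz)
  set u : ℂ → ℝ := fun z => Ufun φ F (r • z) with hu
  have hmem {z : ℂ} (hz : ‖z‖ < 1 / r) : r • z ∈ ball (0 : ℂ) 1 := by
    rw [mem_ball_zero_iff, norm_smul, Real.norm_of_nonneg hr0.le]
    rw [lt_div_iff₀ hr0] at hz; linarith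
  have h1r : 1 < 1 / r := by rw [lt_div_iff₀ hr0]; linarith
  have hucd {z : ℂ} (hz : ‖z‖ < 1 / r) : ContDiffAt ℝ 2 u z := by
    have h := U_cd (hφ _ (hmem hz)) (hFa _ (hmem hz)) (by simpa using hmem hz)
    exact h.comp z (contDiff_const_smul r).contDiffAt
  set δ := (1 / r - 1) / 3 with hδ
  have hδ0 : 0 < δ := by rw [hδ]; linarith
  let χ : ContDiffBump (0 : ℂ) := ⟨1 + δ, 1 + 2 * δ, by linarith, by linarith⟩
  set V : ℂ → ℝ := fun z => χ z * u z with hV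
  have hVcd : ContDiff ℝ 2 V := by
    rw [contDiff_iff_contDiffAt]
    intro z
    by_cases hz : ‖z‖ < 1 / r
    · exact χ.contDiff.contDiffAt.mul (hucd hz)
    · push Not at hz
      have h2 : 1 + 2 * δ < ‖z‖ := by
        refine lt_of_lt_of_le ?_ hz
        rw [hδ]; linarith
      have : V =ᶠ[𝓝 z] fun _ => 0 := by
        filter_upwards [(continuous_norm.tendsto z).eventually (lt_mem_nhds h2)] with y hy
        have : χ y = 0 := χ.zero_of_le_dist (by rw [dist_zero_right]; exact hy.le)
        simp [hV, this]
      exact contDiffAt_const.congr_of_eventuallyEq this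
  have hVc : HasCompactSupport V := χ.hasCompactSupport.mul_right
  have hVu {z : ℂ} (hz : ‖z‖ ≤ 1) : V =ᶠ[𝓝 z] u := by
    have h2 : ‖z‖ < 1 + δ := by linarith
    filter_upwards [(continuous_norm.tendsto z).eventually (gt_mem_nhds h2)] with y hy
    have : χ y = 1 := χ.one_of_mem_closedBall (by rw [mem_closedBall_zero_iff]; exact hy.le)
    simp [hV, this]
  have hW := Wf_cd hw hα
  have hibp := ibp hVcd hVc hW
  have hpos : 0 ≤ ∫ x, Wf w α x * lapR V x := by
    refine integral_nonneg fun z => ?_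
    simp only [Pi.zero_apply]
    by_cases hz : ‖z‖ < 1
    · refine mul_nonneg (Wf_nonneg w α z hw) ?_
      have hm := hmem (hz.trans h1r)
      rw [lapR_congr (hVu hz.le), hu, lapR_scale]
      refine mul_nonneg (sq_nonneg _) ?_
      exact U_sub (hφ _ hm) (hFa _ hm) (by simpa using hm) (hl _ hm)
    · rw [Wf_zero (not_lt.1 hz), zero_mul]
  have hset : ∫ x in ball (0 : ℂ) 1, V x * lapR (Wf w α) x = ∫ x, V x * lapR (Wf w α) x := by
    refine setIntegral_eq_integral_of_ae_compl_eq_zero ?_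
    have hs : ∀ᵐ x : ℂ, x ∉ sphere (0 : ℂ) 1 :=
      measure_eq_zero_iff_ae_notMem.1 (Measure.addHaar_sphere volume 0 1)
    filter_upwards [hs] with z hz hz2
    rw [mem_sphere_zero_iff_norm] at hz
    rw [mem_ball_zero_iff, not_lt] at hz2
    have h3 : 1 < ‖z‖ := lt_of_le_of_ne hz2 (Ne.symm hz)
    have : Wf w α =ᶠ[𝓝 z] fun _ => 0 := by
      filter_upwards [(continuous_norm.tendsto z).eventually (lt_mem_nhds h3)] with y hy
      exact Wf_zero hy.le
    rw [lapR_congr this, lapR_const, mul_zero]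
  have hucont : ContinuousOn u (closedBall 0 1) := fun z hz =>
    (hucd (lt_of_le_of_lt (by simpa using hz) h1r)).continuousAt.continuousWithinAt
  have hintg : IntegrableOn (fun z => u z * ((1 - ‖w‖ ^ 2) ^ 3 / ‖Dw w z‖ ^ 6 * Xf w α z *
      (1 - ‖z‖ ^ 2))) (ball 0 1) := by
    refine IntegrableOn.mono_set ?_ ball_subset_closedBall
    refine ContinuousOn.integrableOn_compact (isCompact_closedBall 0 1) ?_
    exact hucont.mul ((Y_cont hw hα).mul (by fun_prop))
  refine ⟨hintg, ?_⟩
  rw [← hibp, ← hset] at hpos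
  refine hpos.trans (setIntegral_mono_on ?_ hintg measurableSet_ball ?_)
  · exact ((hVcd.continuous.mul (cont_lapR hW)).integrable_of_hasCompactSupport
      hVc.mul_right).integrableOn
  · intro z hz
    rw [mem_ball_zero_iff] at hz
    rw [(hVu hz.le).self_of_nhds]
    have hu0 : 0 ≤ u z := by
      have := oneSub_pos (z := r • z) (by simpa using hmem (hz.trans h1r))
      simp only [hu, Ufun]; positivity
    refine mul_le_mul_of_nonneg_left ((Wf_lap hw hα hz).trans (le_of_eq ?_)) hu0
    ring

open Topology Filter in
lemma main_ineq {φ : ℂ → ℝ} {F : ℂ → ℂ} (hφ : ∀ z ∈ ball (0 : ℂ) 1, ContDiffAt ℝ 2 φ z)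
    (hl : ∀ z ∈ ball (0 : ℂ) 1, - (1 / (1 - ‖z‖ ^ 2) ^ 2) ≤ lapR φ z)
    (hF : DifferentiableOn ℂ F (ball 0 1)) {C : ℝ}
    (hC : ∀ z ∈ ball (0 : ℂ) 1, Real.exp (φ z) * ‖F z‖ ^ 2 ≤ C)
    {w α : ℂ} (hw : ‖w‖ < 1) (hα : ‖α‖ < 1) :
    0 ≤ ∫ z in ball (0 : ℂ) 1, Real.exp (φ z) * ‖F z‖ ^ 2 / ‖Dw w z‖ ^ 6 * Xf w α z := by
  obtain ⟨B, hB⟩ := (isCompact_closedBall (0 : ℂ) 1).exists_bound_of_continuousOn (Y_cont hw hα)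
  have hB0 : 0 ≤ B := (norm_nonneg _).trans (hB 0 (by simp))
  have hC0 : 0 ≤ C := le_trans (by positivity) (hC 0 (by simp))
  have hev : ∀ᶠ r : ℝ in 𝓝[<] 1, r ∈ Ioo (0 : ℝ) 1 := Ioo_mem_nhdsLT zero_lt_one
  have ht : Tendsto (fun r : ℝ => ∫ z in ball (0 : ℂ) 1, Ufun φ F (r • z) *
      ((1 - ‖w‖ ^ 2) ^ 3 / ‖Dw w z‖ ^ 6 * Xf w α z * (1 - ‖z‖ ^ 2))) (𝓝[<] 1)
      (𝓝 (∫ z in ball (0 : ℂ) 1, Ufun φ F z *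
      ((1 - ‖w‖ ^ 2) ^ 3 / ‖Dw w z‖ ^ 6 * Xf w α z * (1 - ‖z‖ ^ 2)))) := by
    refine tendsto_integral_filter_of_dominated_convergence (fun _ => C * B) ?_ ?_ ?_ ?_
    · filter_upwards [hev] with r hr
      exact (main_r hφ hl hF hw hα hr.1 hr.2).1.aestronglyMeasurable
    · filter_upwards [hev] with r hr
      refine (ae_restrict_mem measurableSet_ball).mono fun z hz => ?_
      have hz1 : ‖z‖ < 1 := by simpa using hz
      have hb := hB z (by simpa using hz1.le)
      have hrz : ‖r • z‖ ≤ ‖z‖ := by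
        rw [norm_smul, Real.norm_of_nonneg hr.1.le]
        exact mul_le_of_le_one_left (norm_nonneg _) hr.2.le
      have hp := oneSub_pos hz1
      have hp2 : 1 - ‖z‖ ^ 2 ≤ 1 - ‖r • z‖ ^ 2 := by
        nlinarith [norm_nonneg (r • z)]
      have hc := hC (r • z) (by simpa using lt_of_le_of_lt hrz hz1)
      rw [norm_mul, norm_mul, Real.norm_of_nonneg hp.le]
      have hU : ‖Ufun φ F (r • z)‖ ≤ C / (1 - ‖z‖ ^ 2) := by
        rw [Ufun, Real.norm_of_nonneg (by have := hp.trans_le hp2; positivity)]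
        exact div_le_div₀ hC0 hc hp hp2
      calc _ ≤ C / (1 - ‖z‖ ^ 2) * (B * (1 - ‖z‖ ^ 2)) := by gcongr
        _ = C * B := by field_simp
    · exact integrableOn_const (by simp [measure_ball_lt_top.ne])
    · refine (ae_restrict_mem measurableSet_ball).mono fun z hz => ?_
      have hz1 : ‖z‖ < 1 := by simpa using hz
      refine Tendsto.mul_const _ ?_
      have hc : ContinuousAt (Ufun φ F) ((1 : ℝ) • z) := by
        rw [one_smul]
        exact (U_cd (hφ z hz) (hF.analyticAt (isOpen_ball.mem_nhds hz)) hz1).continuousAt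
      have h2 : Tendsto (fun r : ℝ => r • z) (𝓝[<] 1) (𝓝 ((1 : ℝ) • z)) :=
        (Continuous.tendsto (by fun_prop) 1).mono_left nhdsWithin_le_nhds
      have h3 := hc.tendsto.comp h2
      rw [one_smul] at h3
      exact h3
  have h0 := ge_of_tendsto ht (hev.mono fun r hr => (main_r hφ hl hF hw hα hr.1 hr.2).2)
  have e : ∫ z in ball (0 : ℂ) 1, Ufun φ F z *
      ((1 - ‖w‖ ^ 2) ^ 3 / ‖Dw w z‖ ^ 6 * Xf w α z * (1 - ‖z‖ ^ 2))
      = ∫ z in ball (0 : ℂ) 1, (1 - ‖w‖ ^ 2) ^ 3 *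
        (Real.exp (φ z) * ‖F z‖ ^ 2 / ‖Dw w z‖ ^ 6 * Xf w α z) := by
    refine setIntegral_congr_fun measurableSet_ball fun z hz => ?_
    have := oneSub_pos (z := z) (by simpa using hz)
    simp only [Ufun]
    field_simp
  rw [e, integral_const_mul] at h0
  have := oneSub_pos hw
  exact nonneg_of_mul_nonneg_right h0 (by positivity)
end

section
open Filter Topology InnerProductSpace

lemma inv_norm_int (r : ℝ) : IntegrableOn (fun t : ℂ => ‖t‖⁻¹) (ball 0 r) volume := by
  refine (integrableOn_fun_norm_addHaar (volume : Measure ℂ) (f := fun y : ℝ => y⁻¹)).2 ?_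
  rw [Complex.finrank_real_complex]
  have : IntegrableOn (fun _ : ℝ => (1:ℝ)) (Ioo 0 r) := by simp
  refine this.congr_fun (fun y hy => ?_) measurableSet_Ioo
  simp [hy.1.ne']

lemma log_abs_le (x : ℝ) (hx : 0 ≤ x) : |Real.log x| ≤ x⁻¹ + x := by
  rcases hx.eq_or_lt with h | h
  · simp [← h]
  · have h1 := Real.log_le_sub_one_of_pos h
    have h2 := Real.log_le_sub_one_of_pos (inv_pos.2 h)
    rw [Real.log_inv] at h2
    have := inv_pos.2 h
    rw [abs_le]; constructor <;> linarith

lemma log_norm_li : LocallyIntegrable (fun t : ℂ => Real.log ‖t‖) volume := by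
  refine (locallyIntegrable_iff).2 fun k hk => ?_
  obtain ⟨r, hr⟩ := hk.isBounded.subset_ball (0:ℂ)
  refine IntegrableOn.mono_set ?_ hr
  have : IntegrableOn (fun t : ℂ => ‖t‖⁻¹ + r) (ball 0 r) volume :=
    (inv_norm_int r).add (integrableOn_const measure_ball_lt_top.ne)
  refine Integrable.mono' this (Real.measurable_log.comp measurable_norm).aestronglyMeasurable ?_
  filter_upwards [self_mem_ae_restrict measurableSet_ball] with t ht
  have := log_abs_le ‖t‖ (norm_nonneg _)
  rw [Real.norm_eq_abs]
  simp at ht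
  linarith

lemma peak_deriv (x : ℝ) : HasDerivAt (fun y : ℝ => -(1/2) * (1 + y^2)⁻¹) (x * (1 / (1 + x^2)^2)) x := by
  have h : HasDerivAt (fun y : ℝ => 1 + y^2) (2 * x) x := by
    simpa using (hasDerivAt_pow 2 x).const_add 1
  have := (h.inv (by positivity)).const_mul (-(1/2))
  refine this.congr_deriv ?_
  field_simp

lemma peak_lim : Tendsto (fun y : ℝ => -(1/2) * (1 + y^2)⁻¹) atTop (𝓝 0) := by
  have h : Tendsto (fun y : ℝ => 1 + y^2) atTop atTop :=
    tendsto_atTop_add_const_left _ _ (tendsto_pow_atTop two_ne_zero)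
  simpa using (tendsto_inv_atTop_zero.comp h).const_mul (-(1/2 : ℝ))

lemma peak_int : ∫ x : ℂ, (1 / Real.pi) / (1 + ‖x‖^2)^2 = 1 := by
  have h := integral_fun_norm_addHaar (volume : Measure ℂ) (fun y : ℝ => (1 / Real.pi) / (1 + y^2)^2)
  rw [h, Complex.finrank_real_complex]
  have h2 : ∫ y in Ioi (0:ℝ), y ^ (2-1) • ((1 / Real.pi) / (1 + y^2)^2) =
      (1 / Real.pi) * ∫ y in Ioi (0:ℝ), y * (1 / (1 + y^2)^2) := by
    rw [← integral_const_mul]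
    congr 1; ext y; simp; ring
  rw [h2, integral_Ioi_of_hasDerivAt_of_nonneg' (fun x _ => peak_deriv x)
    (fun x hx => mul_nonneg (le_of_lt hx) (by positivity)) peak_lim]
  have : (volume : Measure ℂ).real (ball 0 1) = Real.pi := by
    simp [Measure.real, Complex.volume_ball]
  rw [this]
  have := Real.pi_ne_zero
  norm_num

lemma peak_decay : Tendsto (fun x : ℂ => ‖x‖ ^ (Module.finrank ℝ ℂ) * ((1 / Real.pi) / (1 + ‖x‖^2)^2))
    (Bornology.cobounded ℂ) (𝓝 0) := by
  rw [Complex.finrank_real_complex]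
  have h : Tendsto (fun y : ℝ => (1 / Real.pi) * (1 + y^2)⁻¹) atTop (𝓝 0) := by
    have := peak_lim.const_mul (-(2 / Real.pi))
    simp only [mul_zero] at this
    refine this.congr fun y => by ring
  refine squeeze_zero (fun x => by positivity) (fun x => ?_) (h.comp tendsto_norm_cobounded_atTop)
  simp only [Function.comp]
  have : 0 < 1 + ‖x‖^2 := by positivity
  rw [mul_div_assoc', div_le_iff₀ (by positivity)]
  field_simp
  nlinarith [sq_nonneg ‖x‖]

lemma lapR_normsq (z : ℂ) : lapR (fun w : ℂ => ‖w‖^2) z = 1 := by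
  have := lapR_nsq (f := fun w : ℂ => w) (z := z) analyticAt_id
  simpa using this

def Lc (c : ℝ) (t : ℂ) : ℝ := (1/2) * Real.log (‖t‖^2 + c⁻¹^2)

lemma Lc_cd {c : ℝ} (hc : 0 < c) : ContDiff ℝ 2 (Lc c) := by
  unfold Lc
  refine contDiff_const.mul (ContDiff.log ((contDiff_norm_sq ℝ).add contDiff_const) fun x => ?_)
  positivity

lemma Lc_lap {c : ℝ} (hc : 0 < c) (z : ℂ) : lapR (Lc c) z =
    (Real.pi / 2) * (c^2 * ((1 / Real.pi) / (1 + ‖c • (0 - z)‖^2)^2)) := by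
  have hp : 0 < ‖z‖^2 + c⁻¹^2 := by positivity
  have d1 (x : ℝ) : deriv (fun y : ℝ => (1/2) * Real.log y) x = (1/2) * x⁻¹ := by
    rw [deriv_const_mul_field, Real.deriv_log]
  have d2 (x : ℝ) (hx : x ≠ 0) : deriv (deriv (fun y : ℝ => (1/2) * Real.log y)) x = -(1/2) * (x^2)⁻¹ := by
    have : deriv (fun y : ℝ => (1/2) * Real.log y) = fun x => (1/2) * x⁻¹ := funext d1
    rw [this, deriv_const_mul_field, deriv_inv]; ring
  have cu : ContDiffAt ℝ 2 (fun w : ℂ => ‖w‖^2 + c⁻¹^2) z := ((contDiff_norm_sq ℝ).add contDiff_const).contDiffAt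
  have h := lapR_comp (g := fun y => (1/2) * Real.log y) (u := fun w : ℂ => ‖w‖^2 + c⁻¹^2) (z := z)
    (contDiffAt_const.mul (Real.contDiffAt_log.2 hp.ne')) cu
  have e1 : Lc c = fun w => (1/2) * Real.log (‖w‖^2 + c⁻¹^2) := rfl
  rw [e1, h, d1, d2 _ hp.ne', lapR_add (contDiff_norm_sq ℝ).contDiffAt contDiffAt_const, lapR_normsq, lapR_const]
  have f1 (e : ℂ) : fderiv ℝ (fun w : ℂ => ‖w‖^2 + c⁻¹^2) z e = 2 * (z.re * e.re + z.im * e.im) := by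
    have := fderiv_nsq (f := fun w : ℂ => w) (z := z) analyticAt_id e
    rw [fderiv_add_const, this]
    simp
  rw [f1, f1]
  have hn : ‖z‖^2 = z.re^2 + z.im^2 := nsq z
  have hn2 : ‖c • (0 - z)‖^2 = c^2 * ‖z‖^2 := by
    rw [norm_smul, mul_pow, Real.norm_eq_abs, sq_abs, zero_sub, norm_neg]
  rw [hn2]
  have : ((1:ℝ) / 4) * (-(1/2) * ((‖z‖^2 + c⁻¹^2)^2)⁻¹) * ((2 * (z.re * (1:ℂ).re + z.im * (1:ℂ).im))^2 +
     (2 * (z.re * I.re + z.im * I.im))^2) = -(1/2) * ((‖z‖^2 + c⁻¹^2)^2)⁻¹ * ‖z‖^2 := by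
    rw [hn]; simp; ring
  rw [this]
  have hpi := Real.pi_ne_zero
  generalize ‖z‖^2 = x at *
  have : 1 + c^2 * x ≠ 0 := by
    have : 1 + c^2 * x = c^2 * (x + c⁻¹^2) := by field_simp; ring
    rw [this]; positivity
  have e2 : x + c⁻¹^2 = (1 + c^2 * x) / c^2 := by field_simp; ring
  rw [e2]
  field_simp
  ring

lemma lapR_cs {V : ℂ → ℝ} (hc : HasCompactSupport V) : HasCompactSupport (lapR V) := by
  have h (e : ℂ) := ((hc.fderiv_apply (𝕜 := ℝ) e).fderiv_apply (𝕜 := ℝ) e)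
  have := ((h 1).add (h I)).mul_left (f := fun _ : ℂ => (1/4 : ℝ))
  exact this

lemma li_mul_int {f g : ℂ → ℝ} (hf : LocallyIntegrable f volume) (hg : Continuous g)
    (hc : HasCompactSupport g) : Integrable (fun x => f x * g x) := by
  have := hf.integrable_smul_right_of_hasCompactSupport hg hc
  simpa using this

lemma fund {V : ℂ → ℝ} (hV : ContDiff ℝ 2 V) (hc : HasCompactSupport V) :
    ∫ t, Real.log ‖t‖ * lapR V t = Real.pi / 2 * V 0 := by
  have T1 : Tendsto (fun c : ℝ => ∫ t, V t * lapR (Lc c) t) atTop (𝓝 (Real.pi / 2 * V 0)) := by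
    have := (tendsto_integral_comp_smul_smul_of_integrable' (μ := (volume : Measure ℂ))
      (φ := fun x : ℂ => (1 / Real.pi) / (1 + ‖x‖^2)^2) (fun x => by positivity) peak_int
      peak_decay (g := V) (x₀ := 0) (hV.continuous.integrable_of_hasCompactSupport hc)
      hV.continuous.continuousAt).const_mul (Real.pi / 2)
    refine this.congr' ?_
    filter_upwards [eventually_gt_atTop 0] with c hc
    rw [← integral_const_mul]
    congr 1; ext t
    rw [Lc_lap hc, Complex.finrank_real_complex]
    simp only [smul_eq_mul]; ring
  have T2 : Tendsto (fun c : ℝ => ∫ t, Lc c t * lapR V t) atTop (𝓝 (∫ t, Real.log ‖t‖ * lapR V t)) := by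
    have cl := cont_lapR hV
    refine tendsto_integral_filter_of_dominated_convergence
      (fun t => (|Real.log ‖t‖| + ‖t‖^2) * |lapR V t|) ?_ ?_ ?_ ?_
    · filter_upwards [eventually_gt_atTop 0] with c hc
      exact ((Lc_cd hc).continuous.mul cl).aestronglyMeasurable
    · filter_upwards [eventually_ge_atTop 1] with c hc
      have hc0 : 0 < c := by linarith
      have : ∀ᵐ t : ℂ, t ≠ 0 := Measure.ae_ne volume 0
      filter_upwards [this] with t ht
      rw [norm_mul, Real.norm_eq_abs, Real.norm_eq_abs]
      gcongr
      have ht0 : 0 < ‖t‖ := norm_pos_iff.2 ht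
      have l1 : Real.log ‖t‖ ≤ Lc c t := by
        have : Real.log (‖t‖^2) ≤ Real.log (‖t‖^2 + c⁻¹^2) := Real.log_le_log (by positivity) (by simp; positivity)
        rw [Real.log_pow] at this
        unfold Lc; push_cast at this; linarith
      have l2 : Lc c t ≤ ‖t‖^2 := by
        have h1 : c⁻¹^2 ≤ 1 := pow_le_one₀ (by positivity) (inv_le_one_of_one_le₀ hc)
        have := Real.log_le_sub_one_of_pos (x := ‖t‖^2 + c⁻¹^2) (by positivity)
        unfold Lc
        nlinarith [sq_nonneg ‖t‖]
      have := neg_abs_le (Real.log ‖t‖)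
      have := abs_nonneg (Real.log ‖t‖)
      rw [abs_le]; constructor <;> nlinarith [sq_nonneg ‖t‖]
    · have h1 : LocallyIntegrable (fun t : ℂ => |Real.log ‖t‖|) volume := fun x => by
        obtain ⟨u, hu, h⟩ := log_norm_li x
        exact ⟨u, hu, h.norm⟩
      have h2 : LocallyIntegrable (fun t : ℂ => ‖t‖^2) volume :=
        (by fun_prop : Continuous (fun t : ℂ => ‖t‖^2)).locallyIntegrable
      have := li_mul_int (h1.add h2) cl.abs (lapR_cs hc).abs
      exact this
    · have : ∀ᵐ t : ℂ, t ≠ 0 := Measure.ae_ne volume 0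
      filter_upwards [this] with t ht
      refine Tendsto.mul_const _ ?_
      have ht0 : 0 < ‖t‖ := norm_pos_iff.2 ht
      have h1 : Tendsto (fun c : ℝ => ‖t‖^2 + c⁻¹^2) atTop (𝓝 (‖t‖^2)) := by
        simpa using (tendsto_inv_atTop_zero.pow 2).const_add (‖t‖^2)
      have h2 := ((Real.continuousAt_log (by positivity : ‖t‖^2 ≠ 0)).tendsto.comp h1).const_mul (1/2)
      rw [Real.log_pow] at h2
      simpa [Lc, Function.comp_def] using h2
  refine tendsto_nhds_unique T2 (T1.congr' ?_)
  filter_upwards [eventually_gt_atTop 0] with c hc'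
  exact ibp hV hc (Lc_cd hc')
end

section
open Filter Topology InnerProductSpace Convolution

lemma lapR_refl {V : ℂ → ℝ} (hV : ContDiff ℝ 2 V) (z t : ℂ) :
    lapR (fun t => V (z - t)) t = lapR V (z - t) := by
  have h1 (U : ℂ → ℝ) (hU : Differentiable ℝ U) (t e : ℂ) :
      fderiv ℝ (fun t => U (z - t)) t e = - fderiv ℝ U (z - t) e := by
    have h : HasFDerivAt (fun t : ℂ => z - t) (-ContinuousLinearMap.id ℝ ℂ) t :=
      (hasFDerivAt_id t).const_sub z
    have := ((hU (z - t)).hasFDerivAt.comp t h).fderiv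
    have e1 : (U ∘ fun t : ℂ => z - t) = fun t => U (z - t) := rfl
    rw [e1] at this
    rw [this]; simp
  have hd : Differentiable ℝ V := hV.differentiable (by norm_num)
  have h2 (e : ℂ) : fderiv ℝ (fun w => fderiv ℝ (fun t => V (z - t)) w e) t e =
     fderiv ℝ (fun w => fderiv ℝ V w e) (z - t) e := by
    have : (fun w => fderiv ℝ (fun t => V (z - t)) w e) = fun w => -((fun y => fderiv ℝ V y e) (z - w)) := by
      ext w; exact h1 V hd w e
    rw [this, fderiv_fun_neg]
    have := h1 (fun y => fderiv ℝ V y e) (fun y => diff_fderiv_apply hV.contDiffAt e) t e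
    simp only [neg_apply]
    rw [this, neg_neg]
  unfold lapR
  rw [h2, h2]

lemma inv_norm_shift (z : ℂ) (r : ℝ) : IntegrableOn (fun t : ℂ => ‖z - t‖⁻¹) (ball z r) volume := by
  have h := (Measure.measurePreserving_sub_left (volume : Measure ℂ) z)
  have h2 := (h.integrableOn_comp_preimage (Homeomorph.subLeft z).measurableEmbedding
    (f := fun t : ℂ => ‖t‖⁻¹) (s := ball 0 r)).2 (inv_norm_int r)
  have e : (fun x => z - x) ⁻¹' ball (0:ℂ) r = ball z r := by
    ext t; simp [dist_eq_norm, norm_sub_rev]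
  rw [e] at h2
  exact h2

lemma inv_norm_shift_val (z : ℂ) (r : ℝ) :
    ∫ t in ball z r, ‖z - t‖⁻¹ = ∫ t in ball (0:ℂ) r, ‖t‖⁻¹ := by
  have h := (Measure.measurePreserving_sub_left (volume : Measure ℂ) z)
  have h2 := (h.setIntegral_preimage_emb (Homeomorph.subLeft z).measurableEmbedding
    (fun t : ℂ => ‖t‖⁻¹) (ball 0 r))
  have e : (fun x => z - x) ⁻¹' ball (0:ℂ) r = ball z r := by
    ext t; simp [dist_eq_norm, norm_sub_rev]
  rw [e] at h2
  exact h2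

lemma log_shift_li (z : ℂ) : LocallyIntegrable (fun t : ℂ => Real.log ‖z - t‖) volume := by
  refine (locallyIntegrable_iff).2 fun k hk => ?_
  obtain ⟨r, hr⟩ := hk.isBounded.subset_ball z
  refine IntegrableOn.mono_set ?_ hr
  have : IntegrableOn (fun t : ℂ => ‖z - t‖⁻¹ + r) (ball z r) volume :=
    (inv_norm_shift z r).add (integrableOn_const measure_ball_lt_top.ne)
  refine Integrable.mono' this (Real.measurable_log.comp (by fun_prop)).aestronglyMeasurable ?_
  filter_upwards [self_mem_ae_restrict measurableSet_ball] with t ht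
  have := log_abs_le ‖z - t‖ (norm_nonneg _)
  rw [Real.norm_eq_abs]
  rw [mem_ball', dist_eq_norm] at ht
  linarith

def newt (V : ℂ → ℝ) (z : ℂ) : ℝ := ∫ w, Real.log ‖z - w‖ * V w

lemma newt_eq (V : ℂ → ℝ) : newt V =
    convolution (fun t : ℂ => Real.log ‖t‖) V (ContinuousLinearMap.mul ℝ ℝ) volume := by
  ext z
  unfold newt convolution
  rw [← integral_sub_left_eq_self _ volume z]
  simp

lemma newt_cd {V : ℂ → ℝ} (hV : ContDiff ℝ 2 V) (hc : HasCompactSupport V) : ContDiff ℝ 2 (newt V) := by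
  rw [newt_eq]
  exact hc.contDiff_convolution_right _ log_norm_li hV

lemma newt_fderiv {V : ℂ → ℝ} (hV : ContDiff ℝ 1 V) (hc : HasCompactSupport V) (z e : ℂ) :
    fderiv ℝ (newt V) z e = newt (fun w => fderiv ℝ V w e) z := by
  rw [newt_eq, newt_eq, (hc.hasFDerivAt_convolution_right _ log_norm_li hV z).fderiv,
    convolution_precompR_apply _ log_norm_li (hc.fderiv ℝ) (hV.continuous_fderiv one_ne_zero)]

lemma newt_lap {V : ℂ → ℝ} (hV : ContDiff ℝ 2 V) (hc : HasCompactSupport V) (z : ℂ) :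
    lapR (newt V) z = Real.pi / 2 * V z := by
  have h2 (e : ℂ) : fderiv ℝ (fun w => fderiv ℝ (newt V) w e) z e =
     newt (fun w => fderiv ℝ (fun w => fderiv ℝ V w e) w e) z := by
    have : (fun w => fderiv ℝ (newt V) w e) = newt (fun w => fderiv ℝ V w e) := by
      ext w; exact newt_fderiv (hV.of_le (by norm_num)) hc w e
    rw [this, newt_fderiv (cd_fderiv_apply hV e) (hc.fderiv_apply (𝕜 := ℝ) e)]
  have li : LocallyIntegrable (fun t : ℂ => Real.log ‖z - t‖) volume := log_shift_li z
  have h3 : lapR (newt V) z = newt (lapR V) z := by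
    unfold lapR
    rw [h2, h2]
    unfold newt
    have hi (e : ℂ) := li_mul_int li (cont_fderiv2 hV e) ((hc.fderiv_apply (𝕜 := ℝ) e).fderiv_apply (𝕜 := ℝ) e)
    rw [← integral_add (hi 1) (hi I), ← integral_const_mul]
    congr 1; ext w; ring
  rw [h3]
  have hV' : ContDiff ℝ 2 (fun t => V (z - t)) := hV.comp (contDiff_const.sub contDiff_id)
  have hc' : HasCompactSupport (fun t => V (z - t)) := hc.comp_homeomorph (Homeomorph.subLeft z)
  have := fund hV' hc'
  simp only [sub_zero, lapR_refl hV] at this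
  rw [← this]
  unfold newt
  rw [← integral_sub_left_eq_self _ volume z]
  simp

lemma far {m : Measure ℂ} {ν : ℂ → ℝ} {c : ℂ → ℂ} {C : ℝ} (hC : 0 < C) (hν : Integrable ν m)
    (hc : AEStronglyMeasurable c m) (hb : ∀ᵐ w ∂m, ‖c w‖ ≤ C) (z0 : ℂ) :
    HarmonicAt (fun z => ∫ w, Real.log ‖1 + (z - z0) * c w‖ * ν w ∂m) z0 := by
  set F : ℂ → ℂ := fun z => ∫ w, Complex.log (1 + (z - z0) * c w) * (ν w : ℂ) ∂m with hF
  have hr : 0 < 1 / (2 * C) := by positivity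
  have small : ∀ z ∈ ball z0 (1 / (2 * C)), ∀ w, ‖c w‖ ≤ C → ‖(z - z0) * c w‖ ≤ 1/2 := by
    intro z hz w hw
    rw [mem_ball, dist_eq_norm] at hz
    rw [norm_mul]
    calc ‖z - z0‖ * ‖c w‖ ≤ (1 / (2 * C)) * C := by gcongr
      _ = 1/2 := by field_simp
  have meas : ∀ z, AEStronglyMeasurable (fun w => Complex.log (1 + (z - z0) * c w) * (ν w : ℂ)) m := by
    intro z
    have h1 : AEMeasurable (fun w => 1 + (z - z0) * c w) m := (hc.aemeasurable.const_mul _).const_add _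
    exact (Complex.measurable_log.comp_aemeasurable h1).aestronglyMeasurable.mul
      (Complex.continuous_ofReal.comp_aestronglyMeasurable hν.1)
  have int : ∀ z ∈ ball z0 (1 / (2 * C)),
      Integrable (fun w => Complex.log (1 + (z - z0) * c w) * (ν w : ℂ)) m := by
    intro z hz
    refine Integrable.mono' (hν.norm.const_mul (3/4)) (meas z) ?_
    filter_upwards [hb] with w hw
    rw [norm_mul, Complex.norm_real]
    gcongr
    have h := Complex.norm_log_one_add_half_le_self (small z hz w hw)
    have := small z hz w hw
    linarith
  have hdiff : DifferentiableOn ℂ F (ball z0 (1 / (2 * C))) := by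
    intro x hx
    have := (hasDerivAt_integral_of_dominated_loc_of_deriv_le (μ := m) (𝕜 := ℂ)
      (F := fun z w => Complex.log (1 + (z - z0) * c w) * (ν w : ℂ))
      (F' := fun z w => c w / (1 + (z - z0) * c w) * (ν w : ℂ)) (x₀ := x)
      (bound := fun w => 2 * C * ‖ν w‖) (isOpen_ball.mem_nhds hx) (Eventually.of_forall meas)
      (int x hx) ?_ ?_ (hν.norm.const_mul _) ?_).2
    · exact this.differentiableAt.differentiableWithinAt
    · have h1 : AEMeasurable (fun w => c w / (1 + (x - z0) * c w)) m :=
        hc.aemeasurable.div ((hc.aemeasurable.const_mul _).const_add _)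
      exact h1.aestronglyMeasurable.mul (Complex.continuous_ofReal.comp_aestronglyMeasurable hν.1)
    · filter_upwards [hb] with w hw z hz
      rw [norm_mul, Complex.norm_real]
      gcongr
      have h := small z hz w hw
      have h2 : 1/2 ≤ ‖1 + (z - z0) * c w‖ := by
        have := norm_sub_le_norm_add (1:ℂ) ((z - z0) * c w)
        rw [norm_one] at this; linarith
      rw [norm_div, div_le_iff₀ (by linarith)]
      nlinarith
    · filter_upwards [hb] with w hw z hz
      have h := small z hz w hw
      have hs : 1 + (z - z0) * c w ∈ Complex.slitPlane :=
        Complex.mem_slitPlane_of_norm_lt_one (by linarith)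
      have h1 : HasDerivAt (fun z => 1 + (z - z0) * c w) (c w) z := by
        simpa using (((hasDerivAt_id z).sub_const z0).mul_const (c w)).const_add 1
      exact (h1.clog hs).mul_const _
  have han : AnalyticAt ℂ F z0 := hdiff.analyticAt (ball_mem_nhds _ hr)
  have hh := han.harmonicAt_re
  refine (harmonicAt_congr_nhds ?_).1 hh
  filter_upwards [ball_mem_nhds z0 hr] with z hz
  simp only [hF]
  have h := integral_re (int z hz)
  have h' : (∫ w, Complex.log (1 + (z - z0) * c w) * (ν w : ℂ) ∂m).re =
    ∫ w, (Complex.log (1 + (z - z0) * c w) * (ν w : ℂ)).re ∂m := h.symm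
  rw [h']
  congr 1; ext w
  simp [Complex.log_re]
end

section
open Filter Topology InnerProductSpace

def Phi (μ : ℂ → ℝ) (z : ℂ) : ℝ :=
  -∫ w in unitDisk, Real.log ‖(z - w) / (1 - z * (starRingEnd ℂ) w)‖ * μ w ∂dSigma

lemma setInt_dSigma {E : Type*} [NormedAddCommGroup E] [NormedSpace ℝ E] (f : ℂ → E) :
    ∫ w in unitDisk, f w ∂dSigma = (1 / Real.pi) • ∫ w in ball (0:ℂ) 1, f w := by
  unfold dSigma unitDisk
  rw [Measure.restrict_smul, integral_smul_measure, ENNReal.toReal_ofReal (by positivity)]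

lemma intOn_dSigma {E : Type*} [NormedAddCommGroup E] (f : ℂ → E) :
    IntegrableOn f unitDisk dSigma ↔ IntegrableOn f (ball (0:ℂ) 1) volume := by
  unfold dSigma unitDisk IntegrableOn
  rw [Measure.restrict_smul, integrable_smul_measure]
  · simp; positivity
  · exact ENNReal.ofReal_ne_top

lemma Phi_eq (μ : ℂ → ℝ) (z : ℂ) : Phi μ z =
    -((1 / Real.pi) * ∫ w in ball (0:ℂ) 1, Real.log ‖(z - w) / Dw w z‖ * μ w) := by
  unfold Phi
  rw [setInt_dSigma]
  simp only [Dw, smul_eq_mul, mul_comm z]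

lemma mu_bdd {μ : ℂ → ℝ} (h : ContDiffOn ℝ (⊤ : ℕ∞) μ closedDisk) : ∃ M, 0 ≤ M ∧ ∀ z ∈ ball (0:ℂ) 1, |μ z| ≤ M := by
  have hc : IsCompact closedDisk := isCompact_closedBall 0 1
  obtain ⟨M, hM⟩ := hc.exists_bound_of_continuousOn h.continuousOn
  refine ⟨max M 0, le_max_right _ _, fun z hz => (hM z ?_).trans (le_max_left _ _)⟩
  exact ball_subset_closedBall hz

lemma mu_meas {μ : ℂ → ℝ} (h : ContDiffOn ℝ (⊤ : ℕ∞) μ closedDisk) :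
    AEStronglyMeasurable μ (volume.restrict (ball (0:ℂ) 1)) :=
  (h.continuousOn.mono ball_subset_closedBall).aestronglyMeasurable measurableSet_ball

/-- bounded measurable times integrable on the disk -/
lemma mul_bdd_int {m : Measure ℂ} {f μ : ℂ → ℝ} {M : ℝ} (hf : Integrable f m)
    (hm : AEStronglyMeasurable μ m) (hM : ∀ᵐ z ∂m, |μ z| ≤ M) : Integrable (fun z => f z * μ z) m := by
  exact hf.mul_bdd hm hM

lemma Phi_bdd {μ : ℂ → ℝ} (h : ContDiffOn ℝ (⊤ : ℕ∞) μ closedDisk) :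
    ∃ C, ∀ z ∈ ball (0:ℂ) 1, Phi μ z ≤ C := by
  obtain ⟨M, hM0, hM⟩ := mu_bdd h
  set J := ∫ t in ball (0:ℂ) 2, ‖t‖⁻¹
  set V := ∫ t in ball (0:ℂ) 1, (1:ℝ)
  refine ⟨(1 / Real.pi) * ((2 * J + V) * M), fun z hz => ?_⟩
  have hz' : ‖z‖ < 1 := by simpa using hz
  rw [Phi_eq, ← mul_neg]
  gcongr
  have sub : ball (0:ℂ) 1 ⊆ ball z 2 := by
    intro w hw
    rw [mem_ball, dist_eq_norm]
    have : ‖w‖ < 1 := by simpa using hw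
    linarith [norm_sub_le w z]
  have i1 : IntegrableOn (fun w : ℂ => ‖z - w‖⁻¹) (ball 0 1) volume := (inv_norm_shift z 2).mono_set sub
  have i2 : IntegrableOn (fun w : ℂ => (1:ℝ)) (ball 0 1) volume := integrableOn_const measure_ball_lt_top.ne
  have e1 : ∫ w in ball (0:ℂ) 1, (2 * ‖z - w‖⁻¹ + 1) * M ≤ (2 * J + V) * M := by
    rw [integral_mul_const, integral_add (i1.const_mul 2) i2, integral_const_mul]
    gcongr
    have := setIntegral_mono_set (inv_norm_shift z 2) (Eventually.of_forall fun w => by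
      simp only [Pi.zero_apply]; positivity) (LE.le.eventuallyLE sub)
    rwa [inv_norm_shift_val] at this
  refine le_trans ((neg_le_abs _).trans ((Real.norm_eq_abs _).symm.le.trans (norm_integral_le_of_norm_le (g := fun w => (2 * ‖z - w‖⁻¹ + 1) * M) ?_ ?_))) e1
  · exact ((i1.const_mul 2).add i2).mul_const M
  · filter_upwards [self_mem_ae_restrict measurableSet_ball] with w hw
    have hw' : ‖w‖ < 1 := by simpa using hw
    have hb := bf_lt hw' hz'
    have hl := log_abs_le ‖(z - w) / Dw w z‖ (norm_nonneg _)
    have hD := Dw_le hw' hz'.le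
    have e2 : ‖(z - w) / Dw w z‖⁻¹ ≤ 2 * ‖z - w‖⁻¹ := by
      rw [norm_div, inv_div, div_eq_mul_inv]; gcongr
    have e3 : ‖(z - w) / Dw w z‖ ≤ 1 := hb.le
    rw [Real.norm_eq_abs]
    calc |Real.log ‖(z - w) / Dw w z‖ * μ w| = |Real.log ‖(z - w) / Dw w z‖| * |μ w| := abs_mul _ _
      _ ≤ (2 * ‖z - w‖⁻¹ + 1) * M := by
        gcongr
        · linarith
        · exact hM w hw


lemma psi_cd {μ : ℂ → ℝ} (h : ContDiffOn ℝ (⊤ : ℕ∞) μ closedDisk) {z0 : ℂ} (χ : ContDiffBump z0)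
    (hχ : closedBall z0 χ.rOut ⊆ ball (0:ℂ) 1) : ContDiff ℝ 2 (fun w => χ w * μ w) := by
  rw [contDiff_iff_contDiffAt]
  intro w
  by_cases hw : w ∈ ball (0:ℂ) 1
  · refine χ.contDiffAt.mul (((h w (ball_subset_closedBall hw)).contDiffAt ?_).of_le ?_)
    · exact mem_of_superset (isOpen_ball.mem_nhds hw) ball_subset_closedBall
    · exact_mod_cast le_top
  · have : (fun w => χ w * μ w) =ᶠ[𝓝 w] fun _ => 0 := by
      have : w ∈ (closedBall z0 χ.rOut)ᶜ := fun h => hw (hχ h)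
      filter_upwards [isClosed_closedBall.isOpen_compl.mem_nhds this] with y hy
      rw [χ.zero_of_le_dist, zero_mul]
      rw [mem_compl_iff, mem_closedBall, not_le] at hy
      exact hy.le
    exact contDiffAt_const.congr_of_eventuallyEq this

lemma Phi_local {μ : ℂ → ℝ} (h : ContDiffOn ℝ (⊤ : ℕ∞) μ closedDisk) {z0 : ℂ} (hz0 : ‖z0‖ < 1) :
    ∃ (V H : ℂ → ℝ), ContDiff ℝ 2 V ∧ HasCompactSupport V ∧ HarmonicAt H z0 ∧ V z0 = μ z0 ∧
      Phi μ =ᶠ[𝓝 z0] fun z => -(1 / Real.pi) * (newt V z + H z) := by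
  obtain ⟨M, hM0, hM⟩ := mu_bdd h
  have hmm := mu_meas h
  have hd : 0 < 1 - ‖z0‖ := by linarith
  let χ : ContDiffBump z0 := ⟨(1 - ‖z0‖)/4, (1 - ‖z0‖)/2, by linarith, by linarith⟩
  have hχ : closedBall z0 χ.rOut ⊆ ball (0:ℂ) 1 := by
    intro w hw
    have : ‖w - z0‖ ≤ (1 - ‖z0‖)/2 := by simpa [χ, dist_eq_norm] using hw
    have h2 : ‖w‖ ≤ ‖w - z0‖ + ‖z0‖ := by simpa using norm_add_le (w - z0) z0
    simp; linarith
  set m := volume.restrict (ball (0:ℂ) 1) with hm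
  have hMae : ∀ᵐ w ∂m, |μ w| ≤ M := by
    filter_upwards [self_mem_ae_restrict measurableSet_ball] with w hw using hM w hw
  have one : Integrable (fun _ : ℂ => (1:ℝ)) m := integrableOn_const measure_ball_lt_top.ne
  have hμi : Integrable μ m := by simpa using mul_bdd_int one hmm hMae
  -- cut-off density
  set ν : ℂ → ℝ := fun w => (1 - χ w) * μ w with hν
  have hχc : Continuous χ := χ.continuous
  have hνm : AEStronglyMeasurable ν m := (continuous_const.sub hχc).aestronglyMeasurable.mul hmm
  have hνb : ∀ᵐ w ∂m, |ν w| ≤ M := by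
    filter_upwards [hMae] with w hw
    rw [hν, abs_mul]
    have h1 := χ.nonneg (x := w)
    have h2 := χ.le_one (x := w)
    have : |1 - χ w| ≤ 1 := by rw [abs_le]; constructor <;> linarith
    calc |1 - χ w| * |μ w| ≤ 1 * M := by gcongr
      _ = M := one_mul _
  have hνi : Integrable ν m := by simpa using mul_bdd_int one hνm hνb
  have logi (z : ℂ) : Integrable (fun w => Real.log ‖z - w‖) m :=
    ((log_shift_li z).integrableOn_isCompact (isCompact_closedBall 0 1)).mono_set ball_subset_closedBall
  set c1 : ℂ → ℂ := fun w => if (1 - ‖z0‖)/4 ≤ ‖z0 - w‖ then (z0 - w)⁻¹ else 0 with hc1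
  set c2 : ℂ → ℂ := fun w => -(starRingEnd ℂ) w / Dw w z0 with hc2
  have f1 := far (C := 4 / (1 - ‖z0‖)) (by positivity) hνi (c := c1) (by
      refine Measurable.aestronglyMeasurable ?_
      refine Measurable.ite (measurableSet_le measurable_const (by fun_prop)) (by fun_prop) measurable_const)
      (Eventually.of_forall fun w => by
        rw [hc1]; dsimp only; split_ifs with hh
        · rw [norm_inv, inv_le_comm₀ (by linarith) (by positivity)]; simpa using hh
        · simp; positivity) z0
  have hc2b : ∀ w ∈ ball (0:ℂ) 1, ‖c2 w‖ ≤ 1 / (1 - ‖z0‖) := by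
    intro w hw
    have hw' : ‖w‖ < 1 := by simpa using hw
    rw [hc2]; dsimp only
    rw [norm_div, norm_neg, RCLike.norm_conj]
    have h1 : ‖(starRingEnd ℂ) w * z0‖ ≤ ‖z0‖ := by
      rw [norm_mul, RCLike.norm_conj]; exact mul_le_of_le_one_left (norm_nonneg _) hw'.le
    have h2 : 1 - ‖z0‖ ≤ ‖Dw w z0‖ := by
      have := norm_sub_norm_le (1:ℂ) ((starRingEnd ℂ) w * z0)
      rw [norm_one] at this
      unfold Dw; linarith
    gcongr
  have f2 := far (C := 1 / (1 - ‖z0‖)) (by positivity) hμi (c := c2) (by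
      refine Measurable.aestronglyMeasurable ?_
      rw [hc2]; unfold Dw
      exact (Complex.continuous_conj.neg.measurable).div (by fun_prop))
      (by filter_upwards [self_mem_ae_restrict measurableSet_ball] with w hw using hc2b w hw) z0
  set A1 := ∫ w, Real.log ‖z0 - w‖ * ν w ∂m
  set A2 := ∫ w, Real.log ‖Dw w z0‖ * μ w ∂m
  set H1 := fun z => ∫ w, Real.log ‖1 + (z - z0) * c1 w‖ * ν w ∂m with hH1
  set H2 := fun z => ∫ w, Real.log ‖1 + (z - z0) * c2 w‖ * μ w ∂m with hH2
  refine ⟨fun w => χ w * μ w, fun z => (H1 z + A1) - (H2 z + A2), psi_cd h χ hχ, χ.hasCompactSupport.mul_right, ?_, ?_, ?_⟩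
  · exact (f1.add (harmonicAt_const A1)).sub (f2.add (harmonicAt_const A2))
  · have : χ z0 = 1 := χ.one_of_mem_closedBall (mem_closedBall_self (by simp [χ]; linarith))
    simp [this]
  · filter_upwards [isOpen_ball.mem_nhds (by simpa using hz0 : z0 ∈ ball (0:ℂ) 1),
      ball_mem_nhds z0 (by linarith : 0 < (1 - ‖z0‖)/4)] with z hz hzz
    have hz' : ‖z‖ < 1 := by simpa using hz
    rw [Phi_eq, neg_mul]
    congr 2
    -- pieces
    have hχb : ∀ᵐ w ∂m, |χ w * μ w| ≤ M := by
      filter_upwards [hMae] with w hw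
      rw [abs_mul, abs_of_nonneg χ.nonneg]
      calc χ w * |μ w| ≤ 1 * M := by gcongr; exact χ.le_one
        _ = M := one_mul _
    have i1 : Integrable (fun w => Real.log ‖z - w‖ * (χ w * μ w)) m :=
      mul_bdd_int (logi z) (hχc.aestronglyMeasurable.mul hmm) hχb
    have i2 (z : ℂ) : Integrable (fun w => Real.log ‖z - w‖ * ν w) m := mul_bdd_int (logi z) hνm hνb
    have i3 (z : ℂ) (hz' : ‖z‖ < 1) : Integrable (fun w => Real.log ‖Dw w z‖ * μ w) m := by
      refine mul_bdd_int (M := M) ?_ hmm hMae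
      have hDl : ∀ w ∈ ball (0:ℂ) 1, 1 - ‖z‖ ≤ ‖Dw w z‖ := by
        intro w hw
        have hw' : ‖w‖ < 1 := by simpa using hw
        have h1 : ‖(starRingEnd ℂ) w * z‖ ≤ ‖z‖ := by
          rw [norm_mul, RCLike.norm_conj]; exact mul_le_of_le_one_left (norm_nonneg _) hw'.le
        have := norm_sub_norm_le (1:ℂ) ((starRingEnd ℂ) w * z)
        rw [norm_one] at this
        unfold Dw; linarith
      refine Integrable.mono' (g := fun _ => (1 - ‖z‖)⁻¹ + 2) (integrableOn_const measure_ball_lt_top.ne) ?_ ?_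
      · refine Measurable.aestronglyMeasurable (Real.measurable_log.comp ?_)
        unfold Dw
        exact (by fun_prop : Continuous fun w : ℂ => ‖1 - (starRingEnd ℂ) w * z‖).measurable
      · filter_upwards [self_mem_ae_restrict measurableSet_ball] with w hw
        have hw' : ‖w‖ < 1 := by simpa using hw
        refine (log_abs_le _ (norm_nonneg _)).trans ?_
        have := hDl w hw
        have hp : 0 < 1 - ‖z‖ := by linarith
        gcongr
        exact Dw_le hw' hz'.le
    have e1 : newt (fun w => χ w * μ w) z = ∫ w, Real.log ‖z - w‖ * (χ w * μ w) ∂m := by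
      unfold newt
      rw [hm, setIntegral_eq_integral_of_forall_compl_eq_zero]
      intro w hw
      rw [χ.zero_of_le_dist]; · simp
      by_contra hcon
      exact hw (hχ (mem_closedBall.2 (not_le.1 hcon).le))
    have e2 : H1 z + A1 = ∫ w, Real.log ‖z - w‖ * ν w ∂m := by
      have key : ∀ w, Real.log ‖1 + (z - z0) * c1 w‖ * ν w = Real.log ‖z - w‖ * ν w - Real.log ‖z0 - w‖ * ν w := by
        intro w
        by_cases hw : (1 - ‖z0‖)/4 ≤ ‖z0 - w‖
        · have hne : z0 - w ≠ 0 := norm_pos_iff.1 (by linarith)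
          have hne2 : z - w ≠ 0 := by
            intro h0
            have : z = w := sub_eq_zero.1 h0
            rw [this, mem_ball', dist_eq_norm] at hzz
            linarith
          have : 1 + (z - z0) * c1 w = (z - w) / (z0 - w) := by
            rw [hc1]; dsimp only; rw [if_pos hw]; field_simp; ring
          rw [this, norm_div, Real.log_div (norm_ne_zero_iff.2 hne2) (norm_ne_zero_iff.2 hne)]
          ring
        · have : χ w = 1 := χ.one_of_mem_closedBall (by
            rw [mem_closedBall', dist_eq_norm]; exact (not_le.1 hw).le)
          simp [hν, this]
      rw [hH1]; dsimp only
      simp_rw [key]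
      rw [integral_sub (i2 z) (i2 z0)]
      ring
    have e3 : H2 z + A2 = ∫ w, Real.log ‖Dw w z‖ * μ w ∂m := by
      have key : ∀ᵐ w ∂m, Real.log ‖1 + (z - z0) * c2 w‖ * μ w = Real.log ‖Dw w z‖ * μ w - Real.log ‖Dw w z0‖ * μ w := by
        filter_upwards [self_mem_ae_restrict measurableSet_ball] with w hw
        have hw' : ‖w‖ < 1 := by simpa using hw
        have hne := Dw_ne hw' hz0.le
        have hne2 := Dw_ne hw' hz'.le
        have : 1 + (z - z0) * c2 w = Dw w z / Dw w z0 := by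
          rw [hc2]; dsimp only; rw [eq_div_iff hne, add_mul, mul_assoc, div_mul_cancel₀ _ hne]; unfold Dw; ring
        rw [this, norm_div, Real.log_div (norm_ne_zero_iff.2 hne2) (norm_ne_zero_iff.2 hne)]
        ring
      rw [hH2]; dsimp only
      rw [integral_congr_ae key, integral_sub (i3 z hz') (i3 z0 hz0)]
      ring
    rw [e1, e2, e3]
    have key : ∀ᵐ w ∂m, Real.log ‖(z - w) / Dw w z‖ * μ w = Real.log ‖z - w‖ * (χ w * μ w) + (Real.log ‖z - w‖ * ν w - Real.log ‖Dw w z‖ * μ w) := by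
      have hne : ∀ᵐ w ∂m, w ≠ z := ae_restrict_of_ae (Measure.ae_ne volume z)
      filter_upwards [self_mem_ae_restrict measurableSet_ball, hne] with w hw hwz
      have hw' : ‖w‖ < 1 := by simpa using hw
      rw [norm_div, Real.log_div (norm_ne_zero_iff.2 (sub_ne_zero.2 hwz.symm)) (norm_ne_zero_iff.2 (Dw_ne hw' hz'.le)), hν]
      ring
    have i4 : Integrable (fun w => Real.log ‖z - w‖ * ν w - Real.log ‖Dw w z‖ * μ w) m := (i2 z).sub (i3 z hz')
    rw [integral_congr_ae key, integral_add i1 i4, integral_sub (i2 z) (i3 z hz')]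

lemma Phi_cd {μ : ℂ → ℝ} (h : ContDiffOn ℝ (⊤ : ℕ∞) μ closedDisk) {z : ℂ} (hz : ‖z‖ < 1) :
    ContDiffAt ℝ 2 (Phi μ) z := by
  obtain ⟨V, H, hV, hc, hH, _, e⟩ := Phi_local h hz
  exact (contDiffAt_const.mul ((newt_cd hV hc).contDiffAt.add hH.1)).congr_of_eventuallyEq e

lemma Phi_lap {μ : ℂ → ℝ} (h : ContDiffOn ℝ (⊤ : ℕ∞) μ closedDisk) {z : ℂ} (hz : ‖z‖ < 1) :
    lapR (Phi μ) z = - μ z / 2 := by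
  obtain ⟨V, H, hV, hc, hH, hVz, e⟩ := Phi_local h hz
  rw [lapR_congr e, lapR_cmul _ ((newt_cd hV hc).contDiffAt.add hH.1),
    lapR_add (newt_cd hV hc).contDiffAt hH.1, newt_lap hV hc, lapR_harm hH, hVz]
  have := Real.pi_ne_zero
  field_simp
  ring
end

section
open Filter Topology InnerProductSpace

/-- admissible log-weight -/
def Adm (φ : ℂ → ℝ) : Prop :=
  (∀ z ∈ ball (0 : ℂ) 1, ContDiffAt ℝ 2 φ z) ∧
  (∀ z ∈ ball (0 : ℂ) 1, - (1 / (1 - ‖z‖ ^ 2) ^ 2) ≤ lapR φ z) ∧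
  ∃ C, 0 ≤ C ∧ ∀ z ∈ ball (0 : ℂ) 1, Real.exp (φ z) ≤ C

lemma Phi_adm {μ : ℂ → ℝ} (h : ContDiffOn ℝ (⊤ : ℕ∞) μ closedDisk)
    (hμ : ∀ z ∈ unitDisk, μ z ≤ 2 / (1 - ‖z‖ ^ 2) ^ 2) : Adm (Phi μ) := by
  refine ⟨fun z hz => Phi_cd h (by simpa using hz), fun z hz => ?_, ?_⟩
  · rw [Phi_lap h (by simpa using hz)]
    have := hμ z hz
    have e : 2 / (1 - ‖z‖ ^ 2) ^ 2 = 2 * (1 / (1 - ‖z‖ ^ 2) ^ 2) := by ring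
    linarith
  · obtain ⟨C, hC⟩ := Phi_bdd h
    exact ⟨Real.exp C, (Real.exp_pos _).le, fun z hz => Real.exp_le_exp.2 (hC z hz)⟩

lemma Adm.cont {φ : ℂ → ℝ} (h : Adm φ) : ContinuousOn (fun z => Real.exp (φ z)) (ball 0 1) :=
  fun z hz => (h.1 z hz).continuousAt.rexp.continuousWithinAt

lemma int_bdd {E : Type*} [NormedAddCommGroup E] {g : ℂ → E}
    {B : ℝ} (hg : ContinuousOn g (ball (0:ℂ) 1)) (hB : ∀ z ∈ ball (0:ℂ) 1, ‖g z‖ ≤ B) :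
    IntegrableOn g (ball (0:ℂ) 1) volume := by
  refine Integrable.mono' (g := fun _ => B) (integrableOn_const measure_ball_lt_top.ne)
    (hg.aestronglyMeasurable measurableSet_ball) ?_
  filter_upwards [self_mem_ae_restrict measurableSet_ball] with z hz using hB z hz

/-- bounded holomorphic functions -/
def BH (f : ℂ → ℂ) : Prop := DifferentiableOn ℂ f (ball 0 1) ∧ ∃ B, 0 ≤ B ∧ ∀ z ∈ ball (0:ℂ) 1, ‖f z‖ ≤ B

lemma BH.mul {f g : ℂ → ℂ} (hf : BH f) (hg : BH g) : BH (fun z => f z * g z) := by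
  obtain ⟨h1, B, hB0, hB⟩ := hf
  obtain ⟨h2, B', hB0', hB'⟩ := hg
  refine ⟨h1.mul h2, B * B', by positivity, fun z hz => ?_⟩
  rw [norm_mul]
  have := hB z hz
  have := hB' z hz
  gcongr

lemma BH.of_cont {f : ℂ → ℂ} (h : DifferentiableOn ℂ f (ball 0 1)) (hc : ContinuousOn f (closedBall 0 1)) : BH f := by
  obtain ⟨B, hB⟩ := (isCompact_closedBall (0 : ℂ) 1).exists_bound_of_continuousOn hc
  refine ⟨h, B, (norm_nonneg _).trans (hB 0 (by simp)), fun z hz => hB z (ball_subset_closedBall hz)⟩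

lemma BH.int_mul_exp {φ : ℂ → ℝ} (h : Adm φ) {f g : ℂ → ℂ} (hf : BH f) (hg : BH g) :
    IntegrableOn (fun z => f z * (starRingEnd ℂ) (g z) * ((Real.exp (φ z) : ℝ) : ℂ)) (ball 0 1) volume := by
  obtain ⟨h1, B, hB0, hB⟩ := hf
  obtain ⟨h2, B', hB0', hB'⟩ := hg
  obtain ⟨C, hC0, hC⟩ := h.2.2
  refine int_bdd (B := B * B' * C) ((h1.continuousOn.mul
    (Complex.continuous_conj.comp_continuousOn h2.continuousOn)).mul
    (Complex.continuous_ofReal.comp_continuousOn h.cont)) fun z hz => ?_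
  rw [norm_mul, norm_mul, RCLike.norm_conj, Complex.norm_real, Real.norm_eq_abs, Real.abs_exp]
  have := hB z hz
  have := hB' z hz
  have := hC z hz
  gcongr

lemma BH.int_sq {φ : ℂ → ℝ} (h : Adm φ) {f : ℂ → ℂ} (hf : BH f) :
    IntegrableOn (fun z => ‖f z‖^2 * Real.exp (φ z)) (ball 0 1) volume := by
  obtain ⟨h1, B, hB0, hB⟩ := hf
  obtain ⟨C, hC0, hC⟩ := h.2.2
  refine int_bdd (B := B^2 * C) ((h1.continuousOn.norm.pow 2).mul h.cont) fun z hz => ?_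
  rw [norm_mul, norm_pow, norm_norm, Real.norm_eq_abs, Real.abs_exp]
  have := hB z hz
  have := hC z hz
  gcongr

lemma BH.memA2 {φ : ℂ → ℝ} (h : Adm φ) {f : ℂ → ℂ} (hf : BH f) :
    MemA2 (fun z => Real.exp (φ z)) f :=
  ⟨hf.1, (intOn_dSigma _).2 (hf.int_sq h)⟩

lemma BH.const (c : ℂ) : BH (fun _ => c) := ⟨differentiableOn_const c, ‖c‖, norm_nonneg _, fun _ _ => le_rfl⟩

lemma rep {φ : ℂ → ℝ} {k : ℂ → ℂ} {w : ℂ} (h : Adm φ) (hr : Reproduces (fun z => Real.exp (φ z)) k w)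
    {f : ℂ → ℂ} (hf : BH f) :
    ∫ z in ball (0:ℂ) 1, f z * (starRingEnd ℂ) (k z) * ((Real.exp (φ z) : ℝ) : ℂ) = Real.pi * f w := by
  have := hr.2 f (hf.memA2 h)
  rw [setInt_dSigma] at this
  rw [← this]
  have := Real.pi_ne_zero
  rw [Complex.real_smul]
  push_cast
  field_simp

lemma sq_conj (f : ℂ → ℂ) (φ : ℂ → ℝ) (z : ℂ) : f z * (starRingEnd ℂ) (f z) * ((Real.exp (φ z) : ℝ) : ℂ) =
   ((‖f z‖^2 * Real.exp (φ z) : ℝ) : ℂ) := by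
  rw [Complex.mul_conj, Complex.normSq_eq_norm_sq]; push_cast; ring

lemma kval {φ : ℂ → ℝ} {k : ℂ → ℂ} {w : ℂ} (h : Adm φ) (hr : Reproduces (fun z => Real.exp (φ z)) k w)
    (hk : BH k) : k w = (((1 / Real.pi) * ∫ z in ball (0:ℂ) 1, ‖k z‖^2 * Real.exp (φ z) : ℝ) : ℂ) := by
  have := rep h hr hk
  simp only [sq_conj] at this
  rw [integral_complex_ofReal] at this
  have hp : (Real.pi : ℂ) ≠ 0 := by exact_mod_cast Real.pi_ne_zero
  push_cast
  field_simp
  rw [this, mul_comm]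

lemma kpos {φ : ℂ → ℝ} {k : ℂ → ℂ} {w : ℂ} (h : Adm φ) (hr : Reproduces (fun z => Real.exp (φ z)) k w)
    (hk : BH k) : 0 < ∫ z in ball (0:ℂ) 1, ‖k z‖^2 * Real.exp (φ z) := by
  have h0 : 0 ≤ ∫ z in ball (0:ℂ) 1, ‖k z‖^2 * Real.exp (φ z) :=
    integral_nonneg fun z => by positivity
  refine h0.lt_of_ne fun he => ?_
  have hz := (integral_eq_zero_iff_of_nonneg (fun z => by positivity) (hk.int_sq h)).1 he.symm
  have h1 := rep h hr (BH.const 1)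
  have : ∫ z in ball (0:ℂ) 1, 1 * (starRingEnd ℂ) (k z) * ((Real.exp (φ z) : ℝ) : ℂ) = 0 := by
    refine integral_eq_zero_of_ae ?_
    filter_upwards [hz] with z hz
    have : ‖k z‖^2 = 0 := by
      rcases mul_eq_zero.1 hz with h | h
      · exact h
      · exact absurd h (Real.exp_pos _).ne'
    have : k z = 0 := by simpa using this
    simp [this]
  rw [this] at h1
  rw [mul_one] at h1
  exact Real.pi_ne_zero (by exact_mod_cast h1.symm)

lemma main2 {φ : ℂ → ℝ} (h : Adm φ) {G : ℂ → ℂ} (hG : BH G) {w α : ℂ} (hw : ‖w‖ < 1) (hα : ‖α‖ < 1) :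
    0 ≤ ∫ z in ball (0 : ℂ) 1, ‖G z‖ ^ 2 * Real.exp (φ z) * Xf w α z := by
  have hD : BH (fun z => Dw w z ^ 3) :=
    BH.of_cont (fun z _ => ((Dw_an w z).differentiableAt.pow 3).differentiableWithinAt)
      (fun z _ => ((Dw_an w z).continuousAt.pow 3).continuousWithinAt)
  obtain ⟨h1, B, hB0, hB⟩ := hG.mul hD
  obtain ⟨C, hC0, hC⟩ := h.2.2
  have := main_ineq h.1 h.2.1 h1 (C := C * B^2) (fun z hz => by
    have := hB z hz
    have := hC z hz
    gcongr) hw hα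
  refine this.trans_eq (setIntegral_congr_fun measurableSet_ball fun z hz => ?_)
  have hz' : ‖z‖ < 1 := by simpa using hz
  have : ‖Dw w z‖ ≠ 0 := norm_ne_zero_iff.2 (Dw_ne hw hz'.le)
  simp only [norm_mul, norm_pow]
  field_simp

lemma sf_BH {w α : ℂ} (hw : ‖w‖ < 1) (hα : ‖α‖ < 1) : BH (fun z => 2 - 2 * sf w α z ^ 3) := by
  refine BH.of_cont (fun z hz => ?_) ?_
  · have := (sf_an hw hα (by simp at hz; exact hz.le : ‖z‖ ≤ 1)).differentiableAt
    exact (((this.pow 3).const_mul 2).const_sub 2).differentiableWithinAt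
  · exact continuousOn_const.sub (continuousOn_const.mul ((sf_cont hw hα).pow 3))

lemma sf_self {w : ℂ} (hw : ‖w‖ < 1) (α : ℂ) : sf w α w = 1 := by
  unfold sf Ef; simp [Dw_ne hw hw.le]

lemma no_int_zero {φ : ℂ → ℝ} {k : ℂ → ℂ} {w : ℂ} (h : Adm φ) (hw : ‖w‖ < 1)
    (hr : Reproduces (fun z => Real.exp (φ z)) k w)
    (hd : DifferentiableOn ℂ k (ball 0 1)) (hc : ContinuousOn k (closedBall 0 1)) {z0 : ℂ} (hz0 : ‖z0‖ < 1) :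
    k z0 ≠ 0 := by
  intro hk0
  have hk := BH.of_cont hd hc
  have hpos := kpos h hr hk
  have hkw := kval h hr hk
  have hne : z0 ≠ w := by
    rintro rfl
    rw [hk0] at hkw
    have : (1 / Real.pi) * ∫ z in ball (0:ℂ) 1, ‖k z‖^2 * Real.exp (φ z) = 0 := by exact_mod_cast hkw.symm
    have h2 : 0 < (1 / Real.pi) * ∫ z in ball (0:ℂ) 1, ‖k z‖^2 * Real.exp (φ z) := by
      have := Real.pi_pos
      positivity
    linarith
  set b := bf w z0 with hb
  set α := (starRingEnd ℂ) b with hα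
  have hD0 := Dw_ne hw hz0.le
  have hbne : b ≠ 0 := div_ne_zero (sub_ne_zero.2 hne) hD0
  have hblt : ‖b‖ < 1 := bf_lt hw hz0
  have hαn : ‖α‖ = ‖b‖ := RCLike.norm_conj _
  have hαlt : ‖α‖ < 1 := by rw [hαn]; exact hblt
  have hαpos : 0 < ‖α‖ := by rw [hαn]; exact norm_pos_iff.2 hbne
  set c := -α * (1 + b * (starRingEnd ℂ) w) with hcdef
  have hcne : c ≠ 0 := by
    refine mul_ne_zero (neg_ne_zero.2 (norm_pos_iff.1 hαpos)) ?_
    have h1 : ‖b * (starRingEnd ℂ) w‖ < 1 := by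
      rw [norm_mul, RCLike.norm_conj]
      exact mul_lt_one_of_nonneg_of_lt_one_left (norm_nonneg _) hblt hw.le
    intro h0
    have : b * (starRingEnd ℂ) w = -1 := by linear_combination h0
    rw [this] at h1; simp at h1
  set G : ℂ → ℂ := fun z => dslope k z0 z * (Ef w α z / c) with hG
  have hnb : ball (0:ℂ) 1 ∈ 𝓝 z0 := isOpen_ball.mem_nhds (by simpa using hz0)
  have hGB : BH G := by
    refine BH.mul (BH.of_cont ?_ ?_) (BH.of_cont ?_ ?_)
    · exact (Complex.differentiableOn_dslope hnb).2 hd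
    · exact (continuousOn_dslope (mem_of_superset hnb ball_subset_closedBall)).2 ⟨hc, hd.differentiableAt hnb⟩
    · exact fun z _ => ((Ef_an w α z).differentiableAt.div_const c).differentiableWithinAt
    · exact fun z _ => ((Ef_an w α z).continuousAt.div_const c).continuousWithinAt
  set Bf : ℂ → ℂ := fun z => 1 - (1 - (‖α‖ : ℂ) ^ 2) * sf w α z with hBf
  have hGk : ∀ z ∈ ball (0:ℂ) 1, G z * Bf z = k z := by
    intro z hz
    have hz' : ‖z‖ < 1 := by simpa using hz
    have hE := Ef_ne hw hαlt hz'.le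
    have h1 : (‖α‖ : ℂ)^2 = α * b := by
      rw [hαn, ← Complex.conj_mul']
    have h2 : Bf z = c * (z - z0) / Ef w α z := by
      rw [hBf]; dsimp only
      rw [h1, sf, eq_div_iff hE, sub_mul, one_mul, mul_assoc, div_mul_cancel₀ _ hE]
      have h3 : b * Dw w z0 = z0 - w := by rw [hb, bf, div_mul_cancel₀ _ hD0]
      rw [hcdef]; unfold Ef Dw at *
      linear_combination α * h3
    have h4 := sub_smul_dslope k z0 z
    rw [hk0, sub_zero, smul_eq_mul] at h4
    rw [h2, hG]; dsimp only
    rw [← h4]; field_simp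
  have hrep := rep h hr ((sf_BH hw hαlt).mul hGB)
  rw [sf_self hw] at hrep
  norm_num at hrep
  have hre := congrArg Complex.re hrep
  have hAk := ((sf_BH hw hαlt).mul hGB).int_mul_exp h hk
  have hre2 : ∫ z in ball (0:ℂ) 1, ((2 - 2 * sf w α z ^ 3) * G z * (starRingEnd ℂ) (k z) * ((Real.exp (φ z) : ℝ) : ℂ)).re = 0 := by
    have e : ∫ z in ball (0:ℂ) 1, ((2 - 2 * sf w α z ^ 3) * G z * (starRingEnd ℂ) (k z) * ((Real.exp (φ z) : ℝ) : ℂ)).re = 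
      (∫ z in ball (0:ℂ) 1, ((2 - 2 * sf w α z ^ 3) * G z * (starRingEnd ℂ) (k z) * ((Real.exp (φ z) : ℝ) : ℂ))).re := integral_re hAk
    rw [e]
    simpa using hre
  have hmain := main2 h hGB hw hαlt
  have heq : ∫ z in ball (0 : ℂ) 1, ‖G z‖ ^ 2 * Real.exp (φ z) * Xf w α z =
      ∫ z in ball (0 : ℂ) 1, (((2 - 2 * sf w α z ^ 3) * G z * (starRingEnd ℂ) (k z) * ((Real.exp (φ z) : ℝ) : ℂ)).re
        - ‖α‖^2 * (‖G z‖^2 * Real.exp (φ z))) := by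
    refine setIntegral_congr_fun measurableSet_ball fun z hz => ?_
    rw [← hGk z hz, map_mul]
    have e1 : (2 - 2 * sf w α z ^ 3) * G z * ((starRingEnd ℂ) (G z) * (starRingEnd ℂ) (Bf z)) * ((Real.exp (φ z) : ℝ) : ℂ) =
      ((‖G z‖^2 * Real.exp (φ z) : ℝ) : ℂ) * ((2 - 2 * sf w α z ^ 3) * (starRingEnd ℂ) (Bf z)) := by
      rw [← sq_conj]; ring
    rw [e1, Complex.re_ofReal_mul, Xf]
    ring
  have hAre : IntegrableOn (fun z => ((2 - 2 * sf w α z ^ 3) * G z * (starRingEnd ℂ) (k z) * ((Real.exp (φ z) : ℝ) : ℂ)).re) (ball 0 1) volume := hAk.re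
  rw [heq, integral_sub hAre ((hGB.int_sq h).const_mul _), hre2, integral_const_mul] at hmain
  have hG0 : ∫ z in ball (0 : ℂ) 1, ‖G z‖^2 * Real.exp (φ z) ≤ 0 := by
    have : 0 < ‖α‖^2 := by positivity
    by_contra hcon
    push Not at hcon
    nlinarith [mul_pos this hcon]
  have hkG : ∫ z in ball (0:ℂ) 1, ‖k z‖^2 * Real.exp (φ z) ≤
      ∫ z in ball (0:ℂ) 1, (1 + 1 / (1 - ‖α‖))^2 * (‖G z‖^2 * Real.exp (φ z)) := by
    refine setIntegral_mono_on (hk.int_sq h) ((hGB.int_sq h).const_mul _) measurableSet_ball fun z hz => ?_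
    have hz' : ‖z‖ < 1 := by simpa using hz
    rw [← hGk z hz, norm_mul]
    have : ‖Bf z‖ ≤ 1 + 1 / (1 - ‖α‖) := by
      refine (norm_sub_le _ _).trans ?_
      rw [norm_one, norm_mul]
      have h1 : ‖(1 - (‖α‖ : ℂ) ^ 2)‖ ≤ 1 := by
        have : (1 - (‖α‖ : ℂ) ^ 2) = ((1 - ‖α‖^2 : ℝ) : ℂ) := by push_cast; ring
        rw [this, Complex.norm_real, Real.norm_eq_abs, abs_le]
        constructor <;> nlinarith
      have h2 := sf_le hw hαlt hz'.le
      nlinarith [norm_nonneg (sf w α z)]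
    have h3 : ‖Bf z‖^2 ≤ (1 + 1 / (1 - ‖α‖))^2 := by gcongr
    have h4 : 0 ≤ ‖G z‖^2 * Real.exp (φ z) := by positivity
    nlinarith [mul_le_mul_of_nonneg_right h3 h4]
  rw [integral_const_mul] at hkG
  nlinarith [sq_nonneg (1 + 1 / (1 - ‖α‖))]
end

section
open Filter Topology InnerProductSpace

lemma lip_of_cd {k : ℂ → ℂ} (hk : ContDiffOn ℝ 1 k (closedBall 0 1)) :
    ∃ L, 0 ≤ L ∧ ∀ x ∈ closedBall (0:ℂ) 1, ∀ y ∈ closedBall (0:ℂ) 1, ‖k y - k x‖ ≤ L * ‖y - x‖ := by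
  have hu : UniqueDiffOn ℝ (closedBall (0:ℂ) 1) :=
    uniqueDiffOn_convex (convex_closedBall 0 1) (by
      rw [interior_closedBall _ one_ne_zero]; exact ⟨0, by simp⟩)
  obtain ⟨L, hL⟩ := (isCompact_closedBall (0 : ℂ) 1).exists_bound_of_continuousOn
    (hk.continuousOn_fderivWithin hu (le_refl _))
  refine ⟨L, (norm_nonneg _).trans (hL 0 (by simp)), fun x hx y hy => ?_⟩
  exact (convex_closedBall (0:ℂ) 1).norm_image_sub_le_of_norm_fderivWithin_le
    (hk.differentiableOn one_ne_zero) hL hx hy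

/-- the pointwise estimate for the limiting argument -/
lemma bdry_est {ζ : ℂ} {ρ : ℝ} (hζ : ‖ζ‖ < 1) (h0 : 0 ≤ ρ) (h1 : ρ < 1) :
    ‖(2 - 2 * ((1 - ρ * ζ)⁻¹)^3) * (starRingEnd ℂ) (-((1 - (ρ:ℂ)^2) * (1 - ρ * ζ)⁻¹))‖ ≤ 64 / ‖1 - ζ‖^3 := by
  have hρζ : ‖(ρ:ℂ) * ζ‖ ≤ ρ := by
    rw [norm_mul, Complex.norm_real, Real.norm_eq_abs, abs_of_nonneg h0]
    exact mul_le_of_le_one_right h0 hζ.le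
  have hlow : 1 - ρ ≤ ‖1 - (ρ:ℂ) * ζ‖ := by
    have := norm_sub_norm_le (1:ℂ) (ρ * ζ)
    rw [norm_one] at this; linarith
  have hp : 0 < ‖1 - (ρ:ℂ) * ζ‖ := by linarith
  have hz1 : 0 < ‖1 - ζ‖ := by
    have := norm_sub_norm_le (1:ℂ) ζ
    rw [norm_one] at this; linarith
  have hz2 : ‖1 - ζ‖ ≤ 2 := by
    have := norm_sub_le (1:ℂ) ζ
    rw [norm_one] at this; linarith
  have hcmp : ‖1 - ζ‖ ≤ 2 * ‖1 - (ρ:ℂ) * ζ‖ := by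
    have e : 1 - ζ = (1 - ρ * ζ) + ((ρ - 1 : ℝ) : ℂ) * ζ := by push_cast; ring
    have h2 : ‖((ρ - 1 : ℝ) : ℂ) * ζ‖ ≤ 1 - ρ := by
      rw [norm_mul, Complex.norm_real, Real.norm_eq_abs, abs_of_neg (by linarith)]
      nlinarith
    rw [e]
    refine (norm_add_le _ _).trans ?_
    linarith
  set s := ‖(1 - (ρ:ℂ) * ζ)⁻¹‖ with hs
  have hsv : s = ‖1 - (ρ:ℂ) * ζ‖⁻¹ := norm_inv _
  have hs0 : 0 ≤ s := norm_nonneg _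
  have hs1 : s ≤ 2 / ‖1 - ζ‖ := by
    rw [hsv, inv_le_comm₀ hp (by positivity), inv_div]; linarith
  have hs2 : (1 - ρ^2) * s ≤ 2 := by
    have : (1 - ρ) * s ≤ 1 := by
      rw [hsv, ← div_eq_mul_inv, div_le_one hp]; exact hlow
    nlinarith
  rw [norm_mul, RCLike.norm_conj, norm_neg, norm_mul]
  have e1 : ‖(1 - (ρ:ℂ)^2)‖ = 1 - ρ^2 := by
    have : (1 - (ρ:ℂ)^2) = ((1 - ρ^2 : ℝ) : ℂ) := by push_cast; ring
    rw [this, Complex.norm_real, Real.norm_eq_abs, abs_of_nonneg (by nlinarith)]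
  have e2 : ‖(2 - 2 * ((1 - (ρ:ℂ) * ζ)⁻¹)^3)‖ ≤ 2 + 2 * s^3 := by
    refine (norm_sub_le _ _).trans ?_
    rw [norm_mul, norm_pow]; simp [hs]
  rw [e1]
  have one : 1 ≤ 2 / ‖1 - ζ‖ := by rw [le_div_iff₀ hz1]; linarith
  set q := 2 / ‖1 - ζ‖ with hq
  have e3 : 2 + 2 * s^3 ≤ 4 * q^3 := by
    have : s^3 ≤ q^3 := by gcongr
    have : 1 ≤ q^3 := one_le_pow₀ one
    linarith
  calc _ ≤ (4 * q^3) * 2 := by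
        refine mul_le_mul (e2.trans e3) hs2 (mul_nonneg (by nlinarith) (norm_nonneg _)) (by positivity)
    _ = 64 / ‖1 - ζ‖^3 := by rw [hq]; field_simp; norm_num

lemma no_bdry_zero {φ : ℂ → ℝ} {k : ℂ → ℂ} {w : ℂ} (h : Adm φ) (hw : ‖w‖ < 1)
    (hr : Reproduces (fun z => Real.exp (φ z)) k w)
    (hd : DifferentiableOn ℂ k (ball 0 1)) (hc : ContDiffOn ℝ 1 k (closedBall 0 1)) {z0 : ℂ} (hz0 : ‖z0‖ = 1) :
    k z0 ≠ 0 := by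
  intro hk0
  have hk := BH.of_cont hd hc.continuousOn
  have hpos := kpos h hr hk
  obtain ⟨L, hL0, hL⟩ := lip_of_cd hc
  obtain ⟨C, hC0, hC⟩ := h.2.2
  have hD0 := Dw_ne hw hz0.le
  set b := bf w z0 with hb
  have hb1 : ‖b‖ = 1 := by
    have := bf_id hw hz0.le
    rw [hz0] at this
    norm_num at this
    have h2 : ‖b‖^2 = 1 := by linarith
    exact (pow_eq_one_iff_of_nonneg (norm_nonneg _) two_ne_zero).1 h2
  set β := (starRingEnd ℂ) b with hβ
  have hβ1 : ‖β‖ = 1 := by rw [hβ, RCLike.norm_conj, hb1]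
  have hβb : β * b = 1 := by
    rw [hβ, Complex.conj_mul', hb1]; simp
  set ζ : ℂ → ℂ := fun z => β * bf w z with hζ
  have hζlt : ∀ z, ‖z‖ < 1 → ‖ζ z‖ < 1 := by
    intro z hz
    rw [hζ]; dsimp only; rw [norm_mul, hβ1, one_mul]; exact bf_lt hw hz
  have hζge : ∀ z, ‖z‖ < 1 → (1 - ‖w‖^2) / 4 * ‖z0 - z‖ ≤ ‖1 - ζ z‖ := by
    intro z hz
    have hDz := Dw_ne hw hz.le
    have e : 1 - ζ z = β * ((z0 - z) * ((1 - ‖w‖^2 : ℝ) : ℂ) / (Dw w z0 * Dw w z)) := by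
      rw [← hβb, hζ]; dsimp only
      rw [← mul_sub, hb, bf, bf]
      congr 1
      have hn : ((‖w‖^2 : ℝ) : ℂ) = w * (starRingEnd ℂ) w := by
        rw [Complex.mul_conj, Complex.normSq_eq_norm_sq]
      rw [div_sub_div _ _ hD0 hDz]
      congr 1
      push_cast at hn ⊢
      rw [hn]; unfold Dw; ring
    rw [e, norm_mul, hβ1, one_mul, norm_div, norm_mul, norm_mul, Complex.norm_real, Real.norm_eq_abs,
      abs_of_nonneg (by nlinarith [norm_nonneg w])]
    have h1 := Dw_le hw hz0.le
    have h2 := Dw_le hw hz.le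
    have p1 : 0 < ‖Dw w z0‖ := norm_pos_iff.2 hD0
    have p2 : 0 < ‖Dw w z‖ := norm_pos_iff.2 hDz
    have h3 : ‖Dw w z0‖ * ‖Dw w z‖ ≤ 4 := by nlinarith
    have h4 : 0 ≤ ‖z0 - z‖ * (1 - ‖w‖^2) := mul_nonneg (norm_nonneg _) (by nlinarith [norm_nonneg w])
    calc _ = ‖z0 - z‖ * (1 - ‖w‖^2) / 4 := by ring
      _ ≤ _ := by gcongr
  -- the function appearing in the limit
  set Q : ℝ → ℂ → ℂ := fun ρ z => (2 - 2 * ((1 - ρ * ζ z)⁻¹)^3) *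
    (starRingEnd ℂ) (-((1 - (ρ:ℂ)^2) * (1 - ρ * ζ z)⁻¹)) with hQ
  have hζc : ContinuousOn ζ (ball 0 1) := fun z hz =>
    (continuousAt_const.mul (bf_an hw (by simp at hz; exact hz.le : ‖z‖ ≤ 1)).continuousAt).continuousWithinAt
  have hne1 : ∀ ρ : ℝ, 0 ≤ ρ → ρ ≤ 1 → ∀ z ∈ ball (0:ℂ) 1, 1 - (ρ:ℂ) * ζ z ≠ 0 := by
    intro ρ h0 h1 z hz h2
    have h3 := hζlt z (by simpa using hz)
    have : (ρ:ℂ) * ζ z = 1 := by linear_combination -h2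
    have := congrArg norm this
    rw [norm_mul, Complex.norm_real, Real.norm_eq_abs, abs_of_nonneg h0, norm_one] at this
    nlinarith [norm_nonneg (ζ z)]
  have hQc : ∀ ρ : ℝ, 0 ≤ ρ → ρ < 1 → ContinuousOn (Q ρ) (ball 0 1) := by
    intro ρ h0 h1
    have hi : ContinuousOn (fun z => (1 - (ρ:ℂ) * ζ z)⁻¹) (ball 0 1) :=
      (continuousOn_const.sub (continuousOn_const.mul hζc)).inv₀ (hne1 ρ h0 h1.le)
    exact (continuousOn_const.sub (continuousOn_const.mul (hi.pow 3))).mul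
      (Complex.continuous_conj.comp_continuousOn (continuousOn_const.mul hi).neg)
  set E : ℝ := C * L^2 * 64 / ((1 - ‖w‖^2) / 4)^3 with hE
  have hw2 : 0 < (1 - ‖w‖^2) / 4 := by nlinarith [norm_nonneg w]
  have hdom : ∀ ρ : ℝ, 0 ≤ ρ → ρ < 1 → ∀ z ∈ ball (0:ℂ) 1,
      ‖‖k z‖^2 * Real.exp (φ z) * (Q ρ z).re‖ ≤ E * ‖z0 - z‖⁻¹ := by
    intro ρ h0 h1 z hz
    have hz' : ‖z‖ < 1 := by simpa using hz
    have hne : 0 < ‖z0 - z‖ := norm_pos_iff.2 (by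
      intro h0
      have : z0 = z := sub_eq_zero.1 h0
      rw [this] at hz0; linarith)
    have q1 : |(Q ρ z).re| ≤ 64 / ‖1 - ζ z‖^3 := (Complex.abs_re_le_norm _).trans (bdry_est (hζlt z hz') h0 h1)
    have q2 := hζge z hz'
    have q3 : ‖k z‖ ≤ L * ‖z0 - z‖ := by
      have := hL z0 (by simp [hz0]) z (ball_subset_closedBall hz)
      rwa [hk0, sub_zero, norm_sub_rev] at this
    have q4 := hC z hz
    rw [norm_mul, norm_mul, norm_pow, norm_norm, Real.norm_eq_abs, Real.norm_eq_abs, Real.abs_exp]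
    calc ‖k z‖^2 * Real.exp (φ z) * |(Q ρ z).re| ≤
        (L * ‖z0 - z‖)^2 * C * (64 / ((1 - ‖w‖^2) / 4 * ‖z0 - z‖)^3) := by
          gcongr
          refine q1.trans ?_
          gcongr
      _ = E * ‖z0 - z‖⁻¹ := by rw [hE]; field_simp
  have hI0 : IntegrableOn (fun z => E * ‖z0 - z‖⁻¹) (ball 0 1) volume := by
    refine Integrable.const_mul ((inv_norm_shift z0 2).mono_set ?_) E
    intro z hz
    rw [mem_ball, dist_eq_norm]
    have : ‖z‖ < 1 := by simpa using hz
    linarith [norm_sub_le z z0]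
  have hmeas : ∀ ρ : ℝ, 0 ≤ ρ → ρ < 1 → AEStronglyMeasurable (fun z => ‖k z‖^2 * Real.exp (φ z) * (Q ρ z).re)
      (volume.restrict (ball (0:ℂ) 1)) := by
    intro ρ h0 h1
    refine ContinuousOn.aestronglyMeasurable ?_ measurableSet_ball
    exact ((hd.continuousOn.norm.pow 2).mul h.cont).mul (Complex.continuous_re.comp_continuousOn (hQc ρ h0 h1))
  have hlim : Tendsto (fun ρ : ℝ => ∫ z in ball (0:ℂ) 1, ‖k z‖^2 * Real.exp (φ z) * (Q ρ z).re)
      (𝓝[<] 1) (𝓝 (∫ z in ball (0:ℂ) 1, (0:ℝ))) := by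
    have hev : ∀ᶠ ρ : ℝ in 𝓝[<] 1, 0 ≤ ρ ∧ ρ < 1 := by
      filter_upwards [self_mem_nhdsWithin, mem_nhdsWithin_of_mem_nhds (Ioi_mem_nhds (zero_lt_one (α := ℝ)))] with ρ h1 h2
      exact ⟨le_of_lt h2, h1⟩
    refine tendsto_integral_filter_of_dominated_convergence (fun z => E * ‖z0 - z‖⁻¹) ?_ ?_ hI0 ?_
    · filter_upwards [hev] with ρ hρ using hmeas ρ hρ.1 hρ.2
    · filter_upwards [hev] with ρ hρ
      filter_upwards [self_mem_ae_restrict measurableSet_ball] with z hz using hdom ρ hρ.1 hρ.2 z hz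
    · filter_upwards [self_mem_ae_restrict measurableSet_ball] with z hz
      have hcQ : ContinuousAt (fun ρ : ℝ => Q ρ z) 1 := by
        have h0 : ContinuousAt (fun ρ : ℝ => 1 - (ρ:ℂ) * ζ z) 1 := by fun_prop
        have hi : ContinuousAt (fun ρ : ℝ => (1 - (ρ:ℂ) * ζ z)⁻¹) 1 :=
          h0.inv₀ (hne1 1 zero_le_one le_rfl z hz)
        have h2 : ContinuousAt (fun ρ : ℝ => 1 - (ρ:ℂ)^2) 1 := by fun_prop
        exact (continuousAt_const.sub (continuousAt_const.mul (hi.pow 3))).mul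
          (Complex.continuous_conj.continuousAt.comp (h2.mul hi).neg)
      have hq1 : Q 1 z = 0 := by simp [hQ]
      have ht := (hcQ.tendsto.mono_left (nhdsWithin_le_nhds (s := Iio 1)))
      rw [hq1] at ht
      have ht2 := (Complex.continuous_re.tendsto 0).comp ht
      have ht3 := ht2.const_mul (‖k z‖^2 * Real.exp (φ z))
      simpa using ht3
  rw [integral_zero] at hlim
  have hineq : ∀ᶠ ρ : ℝ in 𝓝[<] 1, ρ^2 * ∫ z in ball (0:ℂ) 1, ‖k z‖^2 * Real.exp (φ z) ≤
      ∫ z in ball (0:ℂ) 1, ‖k z‖^2 * Real.exp (φ z) * (Q ρ z).re := by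
    filter_upwards [self_mem_nhdsWithin, mem_nhdsWithin_of_mem_nhds (Ioi_mem_nhds (zero_lt_one (α := ℝ)))] with ρ h1 h2
    have h0 : 0 ≤ ρ := le_of_lt h2
    have h1' : ρ < 1 := h1
    have hαn : ‖(ρ:ℂ) * β‖ = ρ := by
      rw [norm_mul, hβ1, mul_one, Complex.norm_real, Real.norm_eq_abs, abs_of_nonneg h0]
    have hαlt : ‖(ρ:ℂ) * β‖ < 1 := by rw [hαn]; exact h1
    have hsf : ∀ z ∈ ball (0:ℂ) 1, sf w (ρ * β) z = (1 - ρ * ζ z)⁻¹ := by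
      intro z hz
      have := sf_mul hw hαlt (by simp at hz; exact hz.le : ‖z‖ ≤ 1)
      rw [eq_inv_of_mul_eq_one_left this, hζ, mul_assoc]
    have hA := (sf_BH hw hαlt).mul hk
    have hrep := rep h hr hA
    rw [sf_self hw] at hrep
    norm_num at hrep
    have hAk := hA.int_mul_exp h hk
    have hre2 : ∫ z in ball (0:ℂ) 1, ((2 - 2 * sf w (ρ * β) z ^ 3) * k z * (starRingEnd ℂ) (k z) * ((Real.exp (φ z) : ℝ) : ℂ)).re = 0 := by
      have e : ∫ z in ball (0:ℂ) 1, ((2 - 2 * sf w (ρ * β) z ^ 3) * k z * (starRingEnd ℂ) (k z) * ((Real.exp (φ z) : ℝ) : ℂ)).re = 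
        (∫ z in ball (0:ℂ) 1, ((2 - 2 * sf w (ρ * β) z ^ 3) * k z * (starRingEnd ℂ) (k z) * ((Real.exp (φ z) : ℝ) : ℂ))).re := integral_re hAk
      rw [e]
      simpa using congrArg Complex.re hrep
    have hAre : IntegrableOn (fun z => ((2 - 2 * sf w (ρ * β) z ^ 3) * k z * (starRingEnd ℂ) (k z) * ((Real.exp (φ z) : ℝ) : ℂ)).re) (ball 0 1) volume := hAk.re
    have hQi : IntegrableOn (fun z => ‖k z‖^2 * Real.exp (φ z) * (Q ρ z).re) (ball 0 1) volume := by
      refine Integrable.mono' hI0 (hmeas ρ h0 h1') ?_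
      filter_upwards [self_mem_ae_restrict measurableSet_ball] with z hz using hdom ρ h0 h1' z hz
    have hmain := main2 h hk hw hαlt
    have heq : ∫ z in ball (0 : ℂ) 1, ‖k z‖ ^ 2 * Real.exp (φ z) * Xf w (ρ * β) z =
        ∫ z in ball (0 : ℂ) 1, (((2 - 2 * sf w (ρ * β) z ^ 3) * k z * (starRingEnd ℂ) (k z) * ((Real.exp (φ z) : ℝ) : ℂ)).re
          + (‖k z‖^2 * Real.exp (φ z) * (Q ρ z).re - ρ^2 * (‖k z‖^2 * Real.exp (φ z)))) := by
      refine setIntegral_congr_fun measurableSet_ball fun z hz => ?_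
      have e1 : (2 - 2 * sf w (ρ * β) z ^ 3) * k z * (starRingEnd ℂ) (k z) * ((Real.exp (φ z) : ℝ) : ℂ) =
        ((‖k z‖^2 * Real.exp (φ z) : ℝ) : ℂ) * (2 - 2 * sf w (ρ * β) z ^ 3) := by
        rw [← sq_conj]; ring
      rw [e1, Complex.re_ofReal_mul, Xf, hαn, hsf z hz, hQ]
      have e2 : (2 - 2 * (1 - ↑ρ * ζ z)⁻¹ ^ 3) * (starRingEnd ℂ) (1 - (1 - (ρ:ℂ) ^ 2) * (1 - ↑ρ * ζ z)⁻¹) =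
        (2 - 2 * (1 - ↑ρ * ζ z)⁻¹ ^ 3) + (2 - 2 * (1 - ↑ρ * ζ z)⁻¹ ^ 3) * (starRingEnd ℂ) (-((1 - (ρ:ℂ) ^ 2) * (1 - ↑ρ * ζ z)⁻¹)) := by
        rw [sub_eq_add_neg 1 ((1 - (ρ:ℂ) ^ 2) * (1 - ↑ρ * ζ z)⁻¹), map_add, map_one]; ring
      rw [e2, Complex.add_re]
      ring
    have hi2 : IntegrableOn (fun z => ‖k z‖^2 * Real.exp (φ z) * (Q ρ z).re - ρ^2 * (‖k z‖^2 * Real.exp (φ z))) (ball 0 1) volume :=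
      hQi.sub ((hk.int_sq h).const_mul _)
    rw [heq, integral_add hAre hi2, integral_sub hQi ((hk.int_sq h).const_mul _), hre2, integral_const_mul] at hmain
    linarith
  have hl2 : Tendsto (fun ρ : ℝ => ρ^2 * ∫ z in ball (0:ℂ) 1, ‖k z‖^2 * Real.exp (φ z)) (𝓝[<] 1)
      (𝓝 (1^2 * ∫ z in ball (0:ℂ) 1, ‖k z‖^2 * Real.exp (φ z))) := by
    have : Continuous (fun ρ : ℝ => ρ^2 * ∫ z in ball (0:ℂ) 1, ‖k z‖^2 * Real.exp (φ z)) := by fun_prop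
    exact (this.tendsto 1).mono_left nhdsWithin_le_nhds
  have := le_of_tendsto_of_tendsto hl2 hlim hineq
  linarith
end

section
open Filter Topology InnerProductSpace

lemma harm_of_lap {u : ℂ → ℝ} (hu : ∀ z ∈ ball (0:ℂ) 1, ContDiffAt ℝ 2 u z)
    (hl : ∀ z ∈ ball (0:ℂ) 1, lapR u z = 0) : HarmonicOnNhd u (ball 0 1) := by
  intro z hz
  refine ⟨hu z hz, ?_⟩
  filter_upwards [isOpen_ball.mem_nhds hz] with y hy
  have := hl y hy
  rw [lapR_eq (hu y hy)] at this
  simpa using this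

lemma harm_of_lapC {u : ℂ → ℂ} (hu : ∀ z ∈ ball (0:ℂ) 1, ContDiffAt ℝ 2 u z)
    (hl : ∀ z ∈ ball (0:ℂ) 1, lapC u z = 0) : HarmonicOnNhd u (ball 0 1) := by
  intro z hz
  refine ⟨hu z hz, ?_⟩
  filter_upwards [isOpen_ball.mem_nhds hz] with y hy
  have := hl y hy
  rw [lapC_eq (hu y hy)] at this
  simpa using this

lemma mean_val {φ : ℂ → ℝ} {k : ℂ → ℂ} (h : Adm φ)
    (hr : Reproduces (fun z => Real.exp (φ z)) k 0) (hk : BH k) {c : ℝ} (hc : k 0 = c)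
    {u : ℂ → ℝ} (hu : HarmonicOnNhd u (ball 0 1)) {M : ℝ} (hM : ∀ z ∈ ball (0:ℂ) 1, |u z| ≤ M) :
    ∫ z in ball (0:ℂ) 1, u z * (‖k z‖^2 * Real.exp (φ z)) = Real.pi * (u 0 * c) := by
  obtain ⟨F, hF, hFu⟩ := HarmonicOnNhd.exists_analyticOnNhd_ball_re_eq hu
  have huc : ContinuousOn u (ball 0 1) := fun z hz => (hu z hz).1.continuousAt.continuousWithinAt
  have hsc : ContinuousOn (fun z => ‖k z‖^2 * Real.exp (φ z)) (ball 0 1) :=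
    (hk.1.continuousOn.norm.pow 2).mul h.cont
  have hmap : ∀ r : ℝ, 0 ≤ r → r < 1 → ∀ z ∈ closedBall (0:ℂ) 1, (r:ℂ) * z ∈ ball (0:ℂ) 1 := by
    intro r h0 h1 z hz
    have hz' : ‖z‖ ≤ 1 := by simpa using hz
    rw [mem_ball_zero_iff, norm_mul, Complex.norm_real, Real.norm_eq_abs, abs_of_nonneg h0]
    nlinarith [norm_nonneg z]
  have step : ∀ r : ℝ, 0 ≤ r → r < 1 →
      ∫ z in ball (0:ℂ) 1, u (r * z) * (‖k z‖^2 * Real.exp (φ z)) = Real.pi * (u 0 * c) := by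
    intro r h0 h1
    have hFr : BH (fun z => F (r * z)) := by
      refine BH.of_cont (fun z hz => ?_) (fun z hz => ?_)
      · have h2 : DifferentiableAt ℂ F (r * z) :=
          (hF _ (hmap r h0 h1 z (ball_subset_closedBall hz))).differentiableAt
        have h3 : DifferentiableAt ℂ (fun z : ℂ => (r:ℂ) * z) z := by fun_prop
        exact (h2.comp z h3).differentiableWithinAt
      · have h2 : ContinuousAt F (r * z) := (hF _ (hmap r h0 h1 z hz)).continuousAt
        have h3 : ContinuousAt (fun z : ℂ => (r:ℂ) * z) z := by fun_prop
        exact (ContinuousAt.comp (f := fun z : ℂ => (r:ℂ) * z) h2 h3).continuousWithinAt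
    have h4 := rep h hr (hFr.mul hk)
    have h5 := (hFr.mul hk).int_mul_exp h hk
    have e : ∫ z in ball (0:ℂ) 1, (F (r * z) * k z * (starRingEnd ℂ) (k z) * ((Real.exp (φ z) : ℝ) : ℂ)).re = 
      (∫ z in ball (0:ℂ) 1, (F (r * z) * k z * (starRingEnd ℂ) (k z) * ((Real.exp (φ z) : ℝ) : ℂ))).re := integral_re h5
    rw [h4, hc, mul_zero] at e
    have hF0 : (F 0).re = u 0 := hFu (by simp)
    have e2 : ((Real.pi : ℂ) * (F 0 * (c : ℂ))).re = Real.pi * (u 0 * c) := by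
      rw [Complex.re_ofReal_mul, Complex.re_mul_ofReal, hF0]
    rw [e2] at e
    rw [← e]
    refine setIntegral_congr_fun measurableSet_ball fun z hz => ?_
    have e3 : F (r * z) * k z * (starRingEnd ℂ) (k z) * ((Real.exp (φ z) : ℝ) : ℂ) =
        ((‖k z‖^2 * Real.exp (φ z) : ℝ) : ℂ) * F (r * z) := by
      rw [← sq_conj]; ring
    have e4 : (F (r * z)).re = u (r * z) := hFu (hmap r h0 h1 z (ball_subset_closedBall hz))
    simp only [e3, Complex.re_ofReal_mul, e4]
    ring
  have hev : ∀ᶠ r : ℝ in 𝓝[<] 1, 0 ≤ r ∧ r < 1 := by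
    filter_upwards [self_mem_nhdsWithin, mem_nhdsWithin_of_mem_nhds (Ioi_mem_nhds (zero_lt_one (α := ℝ)))] with ρ h1 h2
    exact ⟨le_of_lt h2, h1⟩
  have hlim : Tendsto (fun r : ℝ => ∫ z in ball (0:ℂ) 1, u (r * z) * (‖k z‖^2 * Real.exp (φ z))) (𝓝[<] 1)
      (𝓝 (∫ z in ball (0:ℂ) 1, u z * (‖k z‖^2 * Real.exp (φ z)))) := by
    refine tendsto_integral_filter_of_dominated_convergence (fun z => M * (‖k z‖^2 * Real.exp (φ z))) ?_ ?_
      ((hk.int_sq h).const_mul M) ?_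
    · filter_upwards [hev] with r hr
      refine ContinuousOn.aestronglyMeasurable ?_ measurableSet_ball
      refine ContinuousOn.mul (huc.comp (by fun_prop) fun z hz => hmap r hr.1 hr.2 z (ball_subset_closedBall hz)) hsc
    · filter_upwards [hev] with r hr
      filter_upwards [self_mem_ae_restrict measurableSet_ball] with z hz
      have := hM _ (hmap r hr.1 hr.2 z (ball_subset_closedBall hz))
      rw [norm_mul, Real.norm_eq_abs, Real.norm_of_nonneg (by positivity)]
      gcongr
    · filter_upwards [self_mem_ae_restrict measurableSet_ball] with z hz
      refine Tendsto.mul_const _ ?_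
      have h1 : ContinuousAt (fun r : ℝ => (r:ℂ) * z) 1 := by fun_prop
      have h2 : ContinuousAt u (((1:ℝ):ℂ) * z) := by simpa using (hu z hz).1.continuousAt
      have h3 := (ContinuousAt.comp (f := fun r : ℝ => (r:ℂ) * z) h2 h1).tendsto
      simp only [Function.comp_def, ofReal_one, one_mul] at h3
      exact h3.mono_left nhdsWithin_le_nhds
  refine tendsto_nhds_unique hlim (tendsto_const_nhds.congr' ?_)
  filter_upwards [hev] with r hr
  exact (step r hr.1 hr.2).symm

lemma mean_valC {φ : ℂ → ℝ} {k : ℂ → ℂ} (h : Adm φ)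
    (hr : Reproduces (fun z => Real.exp (φ z)) k 0) (hk : BH k) {c : ℝ} (hc : k 0 = c)
    {u : ℂ → ℂ} (hu : BoundedHarmonicC u) :
    ∫ z in ball (0:ℂ) 1, u z * ((‖k z‖^2 * Real.exp (φ z) : ℝ) : ℂ) = Real.pi * (u 0 * c) := by
  obtain ⟨h1, h2, M, hM⟩ := hu
  have hcd : ∀ z ∈ ball (0:ℂ) 1, ContDiffAt ℝ 2 u z := fun z hz =>
    (h1 z hz).contDiffAt (isOpen_ball.mem_nhds hz)
  have hh := harm_of_lapC hcd h2
  have hre : HarmonicOnNhd (fun z => (u z).re) (ball 0 1) := fun z hz => (hh z hz).comp_CLM (l := reCLM)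
  have him : HarmonicOnNhd (fun z => (u z).im) (ball 0 1) := fun z hz => (hh z hz).comp_CLM (l := imCLM)
  have m1 := mean_val h hr hk hc hre (M := M) fun z hz => (Complex.abs_re_le_norm _).trans (hM z hz)
  have m2 := mean_val h hr hk hc him (M := M) fun z hz => (Complex.abs_im_le_norm _).trans (hM z hz)
  have huc : ContinuousOn u (ball 0 1) := fun z hz => (hcd z hz).continuousAt.continuousWithinAt
  have hintg : IntegrableOn (fun z => u z * ((‖k z‖^2 * Real.exp (φ z) : ℝ) : ℂ)) (ball 0 1) volume := by
    refine Integrable.mono' ((hk.int_sq h).const_mul M) ?_ ?_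
    · refine ContinuousOn.aestronglyMeasurable ?_ measurableSet_ball
      exact huc.mul (Complex.continuous_ofReal.comp_continuousOn ((hk.1.continuousOn.norm.pow 2).mul h.cont))
    · filter_upwards [self_mem_ae_restrict measurableSet_ball] with z hz
      have := hM z hz
      rw [norm_mul, Complex.norm_real, Real.norm_of_nonneg (by positivity)]
      gcongr
  apply Complex.ext
  · have e : ∫ z in ball (0:ℂ) 1, (u z * ((‖k z‖^2 * Real.exp (φ z) : ℝ) : ℂ)).re =
      (∫ z in ball (0:ℂ) 1, (u z * ((‖k z‖^2 * Real.exp (φ z) : ℝ) : ℂ))).re := integral_re hintg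
    rw [← e]
    simp only [Complex.re_mul_ofReal, Complex.re_ofReal_mul]
    exact m1
  · have e : ∫ z in ball (0:ℂ) 1, (u z * ((‖k z‖^2 * Real.exp (φ z) : ℝ) : ℂ)).im =
      (∫ z in ball (0:ℂ) 1, (u z * ((‖k z‖^2 * Real.exp (φ z) : ℝ) : ℂ))).im := integral_im hintg
    rw [← e]
    simp only [Complex.im_mul_ofReal, Complex.im_ofReal_mul]
    exact m2

lemma extremal {φ : ℂ → ℝ} {k : ℂ → ℂ} (h : Adm φ)
    (hr : Reproduces (fun z => Real.exp (φ z)) k 0) (hk : BH k) {c : ℝ} (hc : k 0 = c) (hc0 : 0 < c)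
    {ω : ℂ → ℝ} (hp : ∀ z ∈ closedDisk, 0 < ω z) (hs : ContDiffOn ℝ (⊤ : ℕ∞) ω closedDisk)
    (hl : ∀ z ∈ unitDisk, lapR (fun z => Real.log (ω z)) z = lapR φ z)
    (h1 : (∫ z in unitDisk, ω z ∂dSigma) = 1) : ω 0 ≤ c * Real.exp (φ 0) := by
  have hcd : ∀ z ∈ ball (0:ℂ) 1, ContDiffAt ℝ 2 (fun z => Real.log (ω z)) z := by
    intro z hz
    have : ContDiffAt ℝ 2 ω z := ((hs z (ball_subset_closedBall hz)).contDiffAt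
      (mem_of_superset (isOpen_ball.mem_nhds hz) ball_subset_closedBall)).of_le
        (WithTop.coe_le_coe.2 (le_top : (2:ℕ∞) ≤ ⊤))
    exact this.log (hp z (ball_subset_closedBall hz)).ne'
  have hh : HarmonicOnNhd (fun z => Real.log (ω z) - φ z) (ball 0 1) := by
    refine harm_of_lap (fun z hz => (hcd z hz).sub (h.1 z hz)) fun z hz => ?_
    rw [lapR_sub (hcd z hz) (h.1 z hz), hl z hz, sub_self]
  obtain ⟨F, hF, hFu⟩ := HarmonicOnNhd.exists_analyticOnNhd_ball_re_eq hh
  set f : ℂ → ℂ := fun z => Complex.exp (F z / 2) with hf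
  have hfd : DifferentiableOn ℂ f (ball 0 1) := fun z hz =>
    ((hF z hz).differentiableAt.div_const 2).cexp.differentiableWithinAt
  have hfw : ∀ z ∈ ball (0:ℂ) 1, ‖f z‖^2 * Real.exp (φ z) = ω z := by
    intro z hz
    have e : (F z).re = Real.log (ω z) - φ z := hFu hz
    have e2 : (F z / 2).re = (F z).re / 2 := by simp
    rw [hf]; dsimp only
    rw [Complex.norm_exp, ← Real.exp_nat_mul, ← Real.exp_add, e2, e]
    push_cast
    rw [mul_div_cancel₀ _ two_ne_zero, sub_add_cancel, Real.exp_log (hp z (ball_subset_closedBall hz))]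
  have hωi : IntegrableOn ω unitDisk dSigma := by
    rw [intOn_dSigma]
    exact (hs.continuousOn.integrableOn_compact (isCompact_closedBall 0 1)).mono_set ball_subset_closedBall
  have hms : MeasurableSet unitDisk := measurableSet_ball
  have hfi : IntegrableOn (fun z => ‖f z‖^2 * Real.exp (φ z)) unitDisk dSigma :=
    hωi.congr_fun (fun z hz => (hfw z hz).symm) hms
  have hki : IntegrableOn (fun z => ‖k z‖^2 * Real.exp (φ z)) unitDisk dSigma := hr.1.2
  have hrep := hr.2 f ⟨hfd, hfi⟩
  have I1 : ∫ z in unitDisk, ‖f z‖^2 * Real.exp (φ z) ∂dSigma = 1 := by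
    rw [← h1]; exact setIntegral_congr_fun hms hfw
  have I2 : ∫ z in unitDisk, ‖k z‖^2 * Real.exp (φ z) ∂dSigma = c := by
    have := kval h hr hk
    rw [hc] at this
    rw [setInt_dSigma]
    exact_mod_cast this.symm
  set s := Real.sqrt c with hsd
  have hs0 : 0 < s := Real.sqrt_pos.2 hc0
  have hss : s * s = c := Real.mul_self_sqrt hc0.le
  have hb : ‖f 0‖ ≤ s := by
    rw [← hrep]
    have hle : ‖∫ z in unitDisk, f z * (starRingEnd ℂ) (k z) * ((Real.exp (φ z) : ℝ) : ℂ) ∂dSigma‖ ≤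
      ∫ z in unitDisk, ((s / 2) * (‖f z‖^2 * Real.exp (φ z)) + (1 / (2 * s)) * (‖k z‖^2 * Real.exp (φ z))) ∂dSigma := by
      refine norm_integral_le_of_norm_le ((hfi.const_mul _).add (hki.const_mul _)) (Eventually.of_forall fun z => ?_)
      rw [norm_mul, norm_mul, RCLike.norm_conj, Complex.norm_real, Real.norm_eq_abs, Real.abs_exp]
      have e0 : ‖f z‖ * ‖k z‖ ≤ (s / 2) * ‖f z‖^2 + (1 / (2 * s)) * ‖k z‖^2 := by
        have : (s / 2) * ‖f z‖^2 + (1 / (2 * s)) * ‖k z‖^2 - ‖f z‖ * ‖k z‖ = (s * ‖f z‖ - ‖k z‖)^2 / (2 * s) := by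
          field_simp; ring
        have : 0 ≤ (s * ‖f z‖ - ‖k z‖)^2 / (2 * s) := by positivity
        linarith
      have := mul_le_mul_of_nonneg_right e0 (Real.exp_pos (φ z)).le
      linarith
    refine hle.trans_eq ?_
    rw [integral_add (hfi.const_mul _) (hki.const_mul _), integral_const_mul, integral_const_mul, I1, I2, ← hss]
    field_simp; ring
  rw [← hfw 0 (by simp)]
  have : ‖f 0‖^2 ≤ c := by rw [← hss]; nlinarith [norm_nonneg (f 0)]
  gcongr
end

/-- main theorem. If μ is smooth on the closed disk with
μ(z) ≤ 2/(1-|z|²)² on 𝔻, and ω₁ is the associated potential weight, then any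
reproducing kernel K for A²(𝔻,ω₁) (holomorphic in z, C¹ up to the boundary) is
zero-free on cl(𝔻) × 𝔻; the weight ω₀(z) = |K(z,0)|²ω₁(z)/K(0,0) is strictly
positive on the closed disk, satisfies Δ log ω₀ = -μ/2, has total mass one, has
the mean value property for bounded harmonic functions, and is the unique
maximizer of ω(0) among competing weights. -/
theorem statement2 (μ : ℂ → ℝ) (ω₁ ω₀ : ℂ → ℝ) (K : ℂ → ℂ → ℂ)
    (hμsmooth : ContDiffOn ℝ (⊤ : ℕ∞) μ closedDisk)
    (hμ : ∀ z ∈ unitDisk, μ z ≤ 2 / (1 - ‖z‖ ^ 2) ^ 2)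
    (hω₁ : ∀ z : ℂ, ω₁ z =
      Real.exp (-∫ w in unitDisk,
        Real.log ‖(z - w) / (1 - z * (starRingEnd ℂ) w)‖ * μ w ∂dSigma))
    (hK : ∀ w ∈ unitDisk,
      DifferentiableOn ℂ (fun z => K z w) unitDisk ∧
      ContDiffOn ℝ 1 (fun z => K z w) closedDisk ∧
      Reproduces ω₁ (fun z => K z w) w)
    (hω₀ : ∀ z : ℂ, ω₀ z = ‖K z 0‖ ^ 2 * ω₁ z / (K 0 0).re) :
    (∀ z ∈ closedDisk, ∀ w ∈ unitDisk, K z w ≠ 0) ∧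
    (∀ z ∈ closedDisk, 0 < ω₀ z) ∧
    (∀ z ∈ unitDisk, lapR (fun z => Real.log (ω₀ z)) z = -μ z / 2) ∧
    (∫ z in unitDisk, ω₀ z ∂dSigma) = 1 ∧
    (∀ h : ℂ → ℂ, BoundedHarmonicC h →
      ∫ z in unitDisk, h z * (ω₀ z : ℂ) ∂dSigma = h 0) ∧
    (∀ ω : ℂ → ℝ, (∀ z ∈ closedDisk, 0 < ω z) → ContDiffOn ℝ (⊤ : ℕ∞) ω closedDisk →
      (∀ z ∈ unitDisk, lapR (fun z => Real.log (ω z)) z = -μ z / 2) →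
      (∫ z in unitDisk, ω z ∂dSigma) = 1 → ω 0 ≤ ω₀ 0) := by
  have hω : ω₁ = fun z => Real.exp (Phi μ z) := funext hω₁
  have adm : Adm (Phi μ) := Phi_adm hμsmooth hμ
  subst hω
  have hnz : ∀ z ∈ closedDisk, ∀ w ∈ unitDisk, K z w ≠ 0 := by
    intro z hz w hw
    obtain ⟨hd, hc, hr⟩ := hK w hw
    have hw' : ‖w‖ < 1 := by simpa [unitDisk] using hw
    have hz' : ‖z‖ ≤ 1 := by simpa [closedDisk] using hz
    rcases hz'.lt_or_eq with h1 | h1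
    · exact no_int_zero adm hw' hr hd hc.continuousOn h1
    · exact no_bdry_zero adm hw' hr hd hc h1
  have h0 : (0:ℂ) ∈ unitDisk := by simp [unitDisk]
  obtain ⟨hd, hcd, hr⟩ := hK 0 h0
  have hk : BH (fun z => K z 0) := BH.of_cont hd hcd.continuousOn
  have hv : K 0 0 = (((1 / Real.pi) * ∫ z in ball (0:ℂ) 1, ‖K z 0‖^2 * Real.exp (Phi μ z) : ℝ) : ℂ) :=
    kval adm hr hk
  have hp : 0 < ∫ z in ball (0:ℂ) 1, ‖K z 0‖^2 * Real.exp (Phi μ z) := kpos adm hr hk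
  set c := (K 0 0).re with hcdef
  have hcv : c = (1 / Real.pi) * ∫ z in ball (0:ℂ) 1, ‖K z 0‖^2 * Real.exp (Phi μ z) := by
    rw [hcdef, hv, Complex.ofReal_re]
  have hc0 : 0 < c := by rw [hcv]; have := Real.pi_pos; positivity
  have hkc : K 0 0 = (c : ℂ) := by rw [hcv]; exact hv
  have hsub : ∀ z ∈ unitDisk, z ∈ closedDisk := fun z hz => ball_subset_closedBall hz
  have hms : MeasurableSet unitDisk := measurableSet_ball
  have hlap : ∀ z ∈ unitDisk, lapR (Phi μ) z = - μ z / 2 := fun z hz =>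
    Phi_lap hμsmooth (by simpa [unitDisk] using hz)
  refine ⟨hnz, ?_, ?_, ?_, ?_, ?_⟩
  · intro z hz
    have := norm_pos_iff.2 (hnz z hz 0 h0)
    rw [hω₀]
    have := Real.exp_pos (Phi μ z)
    positivity
  · intro z hz
    have hz1 : ‖z‖ < 1 := by simpa [unitDisk] using hz
    have han : AnalyticAt ℂ (fun z => K z 0) z :=
      hd.analyticAt (isOpen_ball.mem_nhds hz)
    have hh := han.harmonicAt_log_norm (hnz z (hsub z hz) 0 h0)
    have hPc := Phi_cd hμsmooth hz1
    have e : (fun z => Real.log (ω₀ z)) =ᶠ[nhds z]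
        fun y => (2 * Real.log ‖K y 0‖ + Phi μ y) - Real.log c := by
      filter_upwards [isOpen_ball.mem_nhds hz] with y hy
      have hy0 := norm_pos_iff.2 (hnz y (hsub y hy) 0 h0)
      rw [hω₀, Real.log_div (mul_pos (pow_pos hy0 2) (Real.exp_pos _)).ne' hc0.ne',
        Real.log_mul (pow_pos hy0 2).ne' (Real.exp_pos _).ne', Real.log_exp, Real.log_pow]
      norm_num
    have h2 : ContDiffAt ℝ 2 (fun y => 2 * Real.log ‖K y 0‖) z := contDiffAt_const.mul hh.1
    rw [lapR_congr e, lapR_sub (h2.add hPc) contDiffAt_const, lapR_add h2 hPc, lapR_cmul (hu := hh.1),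
      lapR_harm hh, lapR_const, hlap z hz]
    ring
  · have e : ∀ z, ω₀ z = (1 / c) * (‖K z 0‖^2 * Real.exp (Phi μ z)) := by
      intro z; rw [hω₀]; ring
    simp only [e]
    rw [setInt_dSigma, integral_const_mul, smul_eq_mul, mul_left_comm, ← hcv]
    field_simp
  · intro h hh
    have m := mean_valC adm hr hk hkc hh
    have e : ∀ z, h z * (ω₀ z : ℂ) = (1 / (c:ℂ)) * (h z * ((‖K z 0‖^2 * Real.exp (Phi μ z) : ℝ) : ℂ)) := by
      intro z; rw [hω₀]; push_cast; ring
    simp only [e]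
    rw [setInt_dSigma, integral_const_mul, m, Complex.real_smul]
    have hcc : (c:ℂ) ≠ 0 := by exact_mod_cast hc0.ne'
    have hpi : (Real.pi : ℂ) ≠ 0 := by exact_mod_cast Real.pi_ne_zero
    push_cast
    field_simp
  · intro ω hpos hs hl h1
    have hx := extremal adm hr hk hkc hc0 hpos hs (fun z hz => by rw [hl z hz, hlap z hz]) h1
    refine hx.trans_eq ?_
    rw [hω₀, hkc, Complex.norm_real, Real.norm_of_nonneg hc0.le]
    field_simp
end
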